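/- For any biconed graph G^{A,B} there is a bijection φ from the set of spanning trees of G^{A,B} to the set of 2-edge-rooted forests of G^{A,B}_red such that for every spanning tree T, the number of internally passive edges of T (with respect to the fixed lexicographic edge order) equals the degree of φ(T). -/

import Mathlib

/-!
Formalization scaffold for "h-vectors of graphic matroids of biconed graphs".

A graph `G` (loops and parallel edges allowed) with vertex set `A ∪ B` is
modelled by an abstract finite edge type `E` with an endpoint map
`ends : E → Sym2 (Fin m ⊕ₗ Fin n)`, where `A = Fin m = {1,…,m}`,
`Ā = B \ A = Fin n = {1̄,…,n̄}` and the finset `S ⊆ Fin m` records `A ∩ B`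
(so `B = S ∪ Ā`).  The biconing `G^{A,B}` adds the two vertices `0` and `0̄`
and the edges `00̄`, `0a (a ∈ A)` and `0̄b (b ∈ B)`.
-/

namespace BiconedPaper

noncomputable section
open scoped Classical

/-! ### Walks in multigraphs presented by an endpoint map -/

/-- A walk in the multigraph with edge set `ε` and endpoint map `ends`. -/
inductive MWalk {ε ν : Type} (ends : ε → Sym2 ν) : ν → ν → Type
  | nil (u : ν) : MWalk ends u u
  | cons {u w : ν} (e : ε) (v : ν) (h : ends e = s(u, v)) (p : MWalk ends v w) :
      MWalk ends u w

namespace MWalk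

variable {ε ν : Type} {ends : ε → Sym2 ν}

/-- The list of edges traversed by a walk. -/
def edges : ∀ {u v : ν}, MWalk ends u v → List ε
  | _, _, nil _ => []
  | _, _, cons e _ _ p => e :: p.edges

/-- The list of vertices visited by a walk. -/
def support : ∀ {u v : ν}, MWalk ends u v → List ν
  | u, _, nil _ => [u]
  | u, _, cons _ _ _ p => u :: p.support

/-- A walk is a path if it visits no vertex twice. -/
def IsPath {u v : ν} (p : MWalk ends u v) : Prop := p.support.Nodup

/-- All edges of the walk belong to the edge set `F`. -/
def edgesIn {u v : ν} (p : MWalk ends u v) (F : Finset ε) : Prop :=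
  ∀ e ∈ p.edges, e ∈ F

/-- The number of "bridging" edges traversed by a walk, i.e. steps whose two
endpoints lie on different sides according to `sideF`. -/
def bridgeCount (sideF : ν → Bool) : ∀ {u v : ν}, MWalk ends u v → ℕ
  | _, _, nil _ => 0
  | u, _, cons _ v' _ p => (if sideF u = sideF v' then 0 else 1) + p.bridgeCount sideF

end MWalk

/-- `u` and `v` are joined by a walk all of whose edges lie in `F`. -/
def Reachable {ε ν : Type} (ends : ε → Sym2 ν) (F : Finset ε) (u v : ν) : Prop :=
  ∃ p : MWalk ends u v, p.edgesIn F

/-- An edge set is acyclic (a forest) iff removing any one of its edges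
disconnects the endpoints of that edge.  (In particular no loops and no
parallel pairs.) -/
def IsAcyclic {ε ν : Type} [DecidableEq ε] (ends : ε → Sym2 ν) (F : Finset ε) : Prop :=
  ∀ e ∈ F, ∀ u v : ν, ends e = s(u, v) → ¬ Reachable ends (F.erase e) u v

/-- A spanning tree: an acyclic edge set connecting every pair of vertices. -/
def IsSpanningTree {ε ν : Type} [DecidableEq ε] (ends : ε → Sym2 ν) (T : Finset ε) : Prop :=
  IsAcyclic ends T ∧ ∀ u v : ν, Reachable ends T u v

/-! ### Biconed graphs -/

/-- The data of a biconed graph `G^{A,B}`:  the graph `G` has vertex set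
`A ∪ B` with `A = Fin m`, `Ā = B \ A = Fin n`, `A ∩ B = S`, and abstract
edge set `E` (so loops and parallel edges are allowed). -/
structure BiconedGraph where
  m : ℕ
  n : ℕ
  E : Type
  fintypeE : Fintype E
  decEqE : DecidableEq E
  ends : E → Sym2 (Fin m ⊕ₗ Fin n)
  S : Finset (Fin m)

namespace BiconedGraph

variable (P : BiconedGraph)

instance : Fintype P.E := P.fintypeE
instance : DecidableEq P.E := P.decEqE

/-- The vertices of `G`, linearly ordered `1 < ⋯ < m < 1̄ < ⋯ < n̄`. -/
abbrev VG := Fin P.m ⊕ₗ Fin P.n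

/-- The vertices of `G^{A,B}_red`:  `⊥` is the vertex `0̄`, ordered
`0̄ < 1 < ⋯ < m < 1̄ < ⋯ < n̄`. -/
abbrev Vred := WithBot P.VG

/-- The vertices of `G^{A,B}`: `⊥` is `0`, ordered `0 < 0̄ < 1 < ⋯ < n̄`. -/
abbrev W := WithBot P.Vred

/-- The vertex `a ∈ A`. -/
def aVert (a : Fin P.m) : P.VG := toLex (Sum.inl a)
/-- The vertex `b ∈ Ā`. -/
def bVert (b : Fin P.n) : P.VG := toLex (Sum.inr b)
/-- Inclusion of the vertices of `G` into those of `G^{A,B}_red`. -/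
def liftV (x : P.VG) : P.Vred := (x : WithBot P.VG)
/-- Inclusion of the vertices of `G^{A,B}_red` into those of `G^{A,B}`. -/
def liftW (x : P.Vred) : P.W := (x : WithBot P.Vred)

/-- The edges of the biconed graph `G^{A,B}`:  the edge `00̄`, the coning
edges `0a (a ∈ A)`, `0̄b (b ∈ Ā)`, `0̄a (a ∈ A ∩ B)`, and the edges of `G`. -/
abbrev EB := Unit ⊕ (Fin P.m ⊕ (Fin P.n ⊕ ({a : Fin P.m // a ∈ P.S} ⊕ P.E)))

/-- The edge `00̄`. -/
abbrev e00 : P.EB := Sum.inl ()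
/-- The coning edge `0a`, `a ∈ A`. -/
abbrev eA (a : Fin P.m) : P.EB := Sum.inr (Sum.inl a)
/-- The coning edge `0̄b`, `b ∈ Ā`. -/
abbrev eB (b : Fin P.n) : P.EB := Sum.inr (Sum.inr (Sum.inl b))
/-- The coning edge `0̄a`, `a ∈ A ∩ B`. -/
abbrev eS (a : {a : Fin P.m // a ∈ P.S}) : P.EB := Sum.inr (Sum.inr (Sum.inr (Sum.inl a)))
/-- An original edge of `G`. -/
abbrev eG (e : P.E) : P.EB := Sum.inr (Sum.inr (Sum.inr (Sum.inr e)))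

/-- The endpoint map of `G^{A,B}`. -/
def endsB : P.EB → Sym2 P.W
  | Sum.inl _ => s((⊥ : P.W), P.liftW ⊥)
  | Sum.inr (Sum.inl a) => s((⊥ : P.W), P.liftW (P.liftV (P.aVert a)))
  | Sum.inr (Sum.inr (Sum.inl b)) => s(P.liftW ⊥, P.liftW (P.liftV (P.bVert b)))
  | Sum.inr (Sum.inr (Sum.inr (Sum.inl a))) => s(P.liftW ⊥, P.liftW (P.liftV (P.aVert a.1)))
  | Sum.inr (Sum.inr (Sum.inr (Sum.inr e))) => (P.ends e).map fun x => P.liftW (P.liftV x)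

/-- The spanning tree `T₀`, consisting of `00̄`, the edges `0a (a ∈ A)` and
the edges `0̄b (b ∈ Ā)`. -/
def T0 : Finset P.EB :=
  Finset.univ.filter fun e => match e with
    | Sum.inl _ => True
    | Sum.inr (Sum.inl _) => True
    | Sum.inr (Sum.inr (Sum.inl _)) => True
    | _ => False

/-- The edges of `G^{A,B}_red` (delete the edges of `T₀` and the vertex `0`):
the edges `0̄a (a ∈ A ∩ B)` together with the edges of `G`. -/
abbrev Ered := {a : Fin P.m // a ∈ P.S} ⊕ P.E

/-- The endpoint map of `G^{A,B}_red`; `⊥` is the vertex `0̄`. -/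
def endsRed : P.Ered → Sym2 P.Vred
  | Sum.inl a => s((⊥ : P.Vred), P.liftV (P.aVert a.1))
  | Sum.inr e => (P.ends e).map P.liftV

/-- Inclusion of the edges of `G^{A,B}_red` into those of `G^{A,B}`. -/
def redToEB : P.Ered → P.EB
  | Sum.inl a => P.eS a
  | Sum.inr e => P.eG e

/-- The edge set `T \ T₀` of `T`, viewed inside `G^{A,B}_red`. -/
def redOf (T : Finset P.EB) : Finset P.Ered :=
  Finset.univ.filter fun e => P.redToEB e ∈ T

/-- `true` on the vertices of `A`, `false` on the vertices of `Ā ∪ {0̄}`. -/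
def side : P.Vred → Bool :=
  WithBot.recBotCoe false fun x => Sum.elim (fun _ => true) (fun _ => false) (ofLex x)

/-- The vertex lies in `A`. -/
def InA (v : P.Vred) : Prop := ∃ a : Fin P.m, v = P.liftV (P.aVert a)

/-- An edge of `G^{A,B}_red` is bridging if it joins a vertex of `A` to a
vertex of `Ā ∪ {0̄}`. -/
def BridgingE (e : P.Ered) : Prop :=
  ∃ u v : P.Vred, P.endsRed e = s(u, v) ∧ P.side u ≠ P.side v

/-! ### 2-edge-rooted forests -/

/-- The underlying edge set `F` of the multiset of edges given by the
multiplicity function `mult` (an edge `e` carries `mult e - 1` edge roots). -/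
def mSupport (mult : P.Ered → ℕ) : Finset P.Ered :=
  Finset.univ.filter fun e => mult e ≠ 0

/-- The degree of the multiset of edges given by `mult`. -/
def deg (mult : P.Ered → ℕ) : ℕ := ∑ e : P.Ered, mult e

/-- Edge `e` meets the connected component of `v` in the edge set `F`. -/
def Touches (F : Finset P.Ered) (v : P.Vred) (e : P.Ered) : Prop :=
  ∃ u : P.Vred, u ∈ P.endsRed e ∧ Reachable P.endsRed F v u

/-- The total number of edge roots in the component of `v`. -/
def compEdgeRoots (mult : P.Ered → ℕ) (v : P.Vred) : ℕ :=
  ∑ e ∈ P.mSupport mult, if P.Touches (P.mSupport mult) v e then mult e - 1 else 0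

/-- The component of `v` is `compCount`-edge-rooted:  the number of its edge
roots, plus `1` if it contains the vertex `0̄`. -/
def compCount (mult : P.Ered → ℕ) (v : P.Vred) : ℕ :=
  P.compEdgeRoots mult v +
    if Reachable P.endsRed (P.mSupport mult) v (⊥ : P.Vred) then 1 else 0

/-- Condition (C3) for the `2`-edge-rooted component of `v`:  the unique
shortest path containing both edge roots (resp. the vertex `0̄` and the edge
root, if the component contains `0̄`) has an odd number of bridging edges.
The shortest path containing two edges is the unique path whose first and
last edges are the two rooted edges; if the two edge roots lie on one common
edge (`mult e = 3`) the path is that single edge. -/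
def C3At (mult : P.Ered → ℕ) (v : P.Vred) : Prop :=
  (Reachable P.endsRed (P.mSupport mult) v (⊥ : P.Vred) →
    ∃ (x : P.Vred) (p : MWalk P.endsRed (⊥ : P.Vred) x),
      p.IsPath ∧ p.edgesIn (P.mSupport mult) ∧
      (∃ e, p.edges.getLast? = some e ∧ 2 ≤ mult e) ∧
      Odd (p.bridgeCount P.side)) ∧
  (¬ Reachable P.endsRed (P.mSupport mult) v (⊥ : P.Vred) →
    ∃ (x y : P.Vred) (p : MWalk P.endsRed x y),
      p.IsPath ∧ p.edgesIn (P.mSupport mult) ∧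
      Reachable P.endsRed (P.mSupport mult) v x ∧
      (∃ e, p.edges.head? = some e ∧ 2 ≤ mult e) ∧
      (∃ e, p.edges.getLast? = some e ∧ 2 ≤ mult e) ∧
      (∀ e, p.edges = [e] → mult e = 3) ∧
      Odd (p.bridgeCount P.side))

/-- `mult : Ered → ℕ` is (the multiplicity function of) a 2-edge-rooted
forest of `G^{A,B}_red`:
(C0) its support is a spanning forest;
(C1) at most one component is `2`-edge-rooted;
(C2) every other component is `0`- or `1`-edge-rooted;
(C3) the parity condition on the path joining the two roots. -/
def Is2ERF (mult : P.Ered → ℕ) : Prop :=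
  IsAcyclic P.endsRed (P.mSupport mult) ∧
  (∀ v : P.Vred, P.compCount mult v ≤ 2) ∧
  (∀ u v : P.Vred, P.compCount mult u = 2 → P.compCount mult v = 2 →
    Reachable P.endsRed (P.mSupport mult) u v) ∧
  (∀ v : P.Vred, P.compCount mult v = 2 → P.C3At mult v)

/-! ### Birooted forests -/

/-- `(F, R)` is a birooted forest of `G^{A,B}_red`:  `F` is a spanning forest,
the root set `R` contains `0̄`, every component of `F` contains at least one
root, no component contains three roots, at most one component contains two
roots, and a component with two roots has one root in `A` and the other in
`Ā ∪ {0̄}`. -/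
def IsBirootedForest (F : Finset P.Ered) (R : Set P.Vred) : Prop :=
  IsAcyclic P.endsRed F ∧
  (⊥ : P.Vred) ∈ R ∧
  (∀ v : P.Vred, ∃ r ∈ R, Reachable P.endsRed F v r) ∧
  (∀ r₁ ∈ R, ∀ r₂ ∈ R, ∀ r₃ ∈ R, r₁ ≠ r₂ → r₁ ≠ r₃ → r₂ ≠ r₃ →
    Reachable P.endsRed F r₁ r₂ → Reachable P.endsRed F r₁ r₃ → False) ∧
  (∀ r₁ ∈ R, ∀ r₂ ∈ R, ∀ r₃ ∈ R, ∀ r₄ ∈ R, r₁ ≠ r₂ → r₃ ≠ r₄ →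
    Reachable P.endsRed F r₁ r₂ → Reachable P.endsRed F r₃ r₄ →
    Reachable P.endsRed F r₁ r₃) ∧
  (∀ r₁ ∈ R, ∀ r₂ ∈ R, r₁ ≠ r₂ → Reachable P.endsRed F r₁ r₂ →
    (P.InA r₁ ∧ ¬ P.InA r₂) ∨ (P.InA r₂ ∧ ¬ P.InA r₁))

/-! ### Internal activity and the edge order -/

/-- `e` is internally passive in the spanning tree `T`:  it can be exchanged
for a strictly smaller edge `f` so that the result is again a spanning tree. -/
def InternallyPassive (ord : LinearOrder P.EB) (T : Finset P.EB) (e : P.EB) : Prop :=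
  e ∈ T ∧ ∃ f : P.EB, ord.lt f e ∧ IsSpanningTree P.endsB (insert f (T.erase e))

/-- `e` is internally active in the spanning tree `T`. -/
def InternallyActive (ord : LinearOrder P.EB) (T : Finset P.EB) (e : P.EB) : Prop :=
  e ∈ T ∧ ¬ ∃ f : P.EB, ord.lt f e ∧ IsSpanningTree P.endsB (insert f (T.erase e))

/-- The number of internally passive edges of `T`. -/
def ipCount (ord : LinearOrder P.EB) (T : Finset P.EB) : ℕ :=
  (T.filter fun e => P.InternallyPassive ord T e).card

/-- The smaller endpoint of an edge of `G^{A,B}`. -/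
def endMin (e : P.EB) : P.W := Sym2.lift ⟨fun a b => a ⊓ b, fun a b => inf_comm a b⟩ (P.endsB e)
/-- The larger endpoint of an edge of `G^{A,B}`. -/
def endMax (e : P.EB) : P.W := Sym2.lift ⟨fun a b => a ⊔ b, fun a b => sup_comm a b⟩ (P.endsB e)

/-- The endpoints of an edge, as an ordered pair in the lexicographic square
of the vertex order `0 < 0̄ < 1 < ⋯ < m < 1̄ < ⋯ < n̄`. -/
def lexEnds (e : P.EB) : P.W ×ₗ P.W := toLex (P.endMin e, P.endMax e)

/-- A linear order on the edges of `G^{A,B}` is admissible if it refines the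
lexicographic order on endpoints (so parallel edges are ordered arbitrarily). -/
def AdmissibleOrder (ord : LinearOrder P.EB) : Prop :=
  ∀ e f : P.EB, P.lexEnds e < P.lexEnds f → ord.lt e f

/-- `v` is a connecting vertex of `T`:  `v ∈ A` and `v` is adjacent to `0` in
`T`, or `v ∈ Ā` and `v` is adjacent to `0̄` in `T`. -/
def ConnVertex (T : Finset P.EB) (v : P.Vred) : Prop :=
  (∃ a : Fin P.m, v = P.liftV (P.aVert a) ∧ P.eA a ∈ T) ∨
  (∃ b : Fin P.n, v = P.liftV (P.bVert b) ∧ P.eB b ∈ T)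

/-- `e` is a connecting edge of `T` (an edge `0a`, `a ∈ A`, or `0̄b`, `b ∈ Ā`)
with connecting vertex `v`. -/
def ConnEdge (T : Finset P.EB) (e : P.EB) (v : P.Vred) : Prop :=
  e ∈ T ∧ ((∃ a : Fin P.m, e = P.eA a ∧ v = P.liftV (P.aVert a)) ∨
           (∃ b : Fin P.n, e = P.eB b ∧ v = P.liftV (P.bVert b)))

/-! ### The h-vector -/

/-- `f_{i-1}`:  the number of acyclic edge sets of cardinality `i` in `G^{A,B}`. -/
def numAcyclic (i : ℕ) : ℕ :=
  Nat.card {F : Finset P.EB // IsAcyclic P.endsB F ∧ F.card = i}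

/-- The rank of the graphic matroid of `G^{A,B}`:  `|V| - 1 = m + n + 1`. -/
def d : ℕ := P.m + P.n + 1

/-- `h` is the h-vector of the graphic matroid of `G^{A,B}`:  it satisfies
`Σ_{i=0}^{d} f_{i-1} (t-1)^{d-i} = Σ_{k=0}^{d} h_k t^{d-k}`. -/
def IsHVector (h : ℕ → ℤ) : Prop :=
  ∑ i ∈ Finset.range (P.d + 1),
      Polynomial.C ((P.numAcyclic i : ℤ)) * (Polynomial.X - 1) ^ (P.d - i)
    = ∑ k ∈ Finset.range (P.d + 1), Polynomial.C (h k) * Polynomial.X ^ (P.d - k)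

end BiconedGraph

/-- `(h 0, …, h d)` is a pure O-sequence:  there is a multicomplex `M` of
multisets on a finite ground set (nonempty, closed under sub-multisets), all
of whose inclusion-maximal members have the same cardinality, whose members
all have cardinality at most `d`, and which has exactly `h i` members of
cardinality `i` for every `i ≤ d`. -/
def IsPureOSeq (d : ℕ) (h : ℕ → ℤ) : Prop :=
  ∃ (N : ℕ) (M : Set (Multiset (Fin N))),
    M.Nonempty ∧
    (∀ s ∈ M, ∀ t : Multiset (Fin N), t ≤ s → t ∈ M) ∧
    (∀ s ∈ M, ∀ t ∈ M, (∀ u ∈ M, s ≤ u → u = s) → (∀ u ∈ M, t ≤ u → u = t) →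
      Multiset.card s = Multiset.card t) ∧
    (∀ s ∈ M, Multiset.card s ≤ d) ∧
    (∀ i ≤ d, (Nat.card {s : Multiset (Fin N) // s ∈ M ∧ Multiset.card s = i} : ℤ) = h i)


set_option linter.unusedSectionVars false

/-! ### General facts on reachability -/

section General

variable {ε ν : Type} {ends : ε → Sym2 ν} {F F' : Finset ε}

theorem Reachable.refl (u : ν) : Reachable ends F u u :=
  ⟨MWalk.nil u, by intro e he; simp [MWalk.edges] at he⟩

theorem Reachable.step {e : ε} {u v w : ν} (he : e ∈ F) (h : ends e = s(u, v))
    (hr : Reachable ends F v w) : Reachable ends F u w := by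
  obtain ⟨p, hp⟩ := hr
  refine ⟨MWalk.cons e v h p, ?_⟩
  intro f hf
  simp only [MWalk.edges, List.mem_cons] at hf
  rcases hf with rfl | hf
  · exact he
  · exact hp f hf

theorem Reachable.ind {Q : ν → Prop}
    (hQ : ∀ e ∈ F, ∀ u v : ν, ends e = s(u, v) → Q u → Q v) {u v : ν}
    (hr : Reachable ends F u v) (hu : Q u) : Q v := by
  obtain ⟨p, hp⟩ := hr
  induction p with
  | nil u => exact hu
  | cons e v h p ih =>
    apply ih
    · exact hQ e (hp e (by simp [MWalk.edges])) _ _ h hu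
    · intro f hf
      exact hp f (by simp [MWalk.edges, hf])

theorem Reachable.edge {e : ε} {u v : ν} (he : e ∈ F) (h : ends e = s(u, v)) :
    Reachable ends F u v := Reachable.step he h (Reachable.refl v)

theorem Reachable.trans {u v w : ν} (h1 : Reachable ends F u v) (h2 : Reachable ends F v w) :
    Reachable ends F u w := by
  obtain ⟨p, hp⟩ := h1
  induction p with
  | nil u => exact h2
  | cons e v h p ih =>
    refine Reachable.step (hp e (by simp [MWalk.edges])) h (ih h2 ?_)
    intro f hf
    exact hp f (by simp [MWalk.edges, hf])

theorem Reachable.symm {u v : ν} (h : Reachable ends F u v) : Reachable ends F v u := by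
  refine Reachable.ind (Q := fun x => Reachable ends F x u) ?_ h (Reachable.refl u)
  intro e he a b hab ha
  exact Reachable.step he (by rw [hab, Sym2.eq_swap]) ha

theorem Reachable.mono (hF : F ⊆ F') {u v : ν} (h : Reachable ends F u v) :
    Reachable ends F' u v := by
  obtain ⟨p, hp⟩ := h
  exact ⟨p, fun e he => hF (hp e he)⟩

theorem Reachable.of_erase [DecidableEq ε] {e : ε} {u v : ν}
    (h : Reachable ends (F.erase e) u v) : Reachable ends F u v :=
  h.mono (Finset.erase_subset _ _)

theorem Reachable.split [DecidableEq ε] {e : ε} {a b u w : ν} (hab : ends e = s(a, b))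
    (h : Reachable ends F u w) :
    Reachable ends (F.erase e) u w ∨
    (Reachable ends (F.erase e) u a ∧ Reachable ends (F.erase e) b w) ∨
    (Reachable ends (F.erase e) u b ∧ Reachable ends (F.erase e) a w) := by
  refine Reachable.ind (Q := fun w => Reachable ends (F.erase e) u w ∨
    (Reachable ends (F.erase e) u a ∧ Reachable ends (F.erase e) b w) ∨
    (Reachable ends (F.erase e) u b ∧ Reachable ends (F.erase e) a w)) ?_ h
    (Or.inl (Reachable.refl u))
  intro f hf x y hxy hx
  by_cases hfe : f = e
  · subst hfe
    rw [hab] at hxy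
    rcases Sym2.eq_iff.1 hxy with ⟨rfl, rfl⟩ | ⟨rfl, rfl⟩
    · rcases hx with hx | ⟨h1, h2⟩ | ⟨h1, h2⟩
      · exact Or.inr (Or.inl ⟨hx, Reachable.refl _⟩)
      · exact Or.inr (Or.inl ⟨h1, Reachable.refl _⟩)
      · exact Or.inl h1
    · rcases hx with hx | ⟨h1, h2⟩ | ⟨h1, h2⟩
      · exact Or.inr (Or.inr ⟨hx, Reachable.refl _⟩)
      · exact Or.inl h1
      · exact Or.inr (Or.inr ⟨h1, Reachable.refl _⟩)
  · have hst : Reachable ends (F.erase e) x y :=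
      Reachable.edge (Finset.mem_erase.2 ⟨hfe, hf⟩) hxy
    rcases hx with hx | ⟨h1, h2⟩ | ⟨h1, h2⟩
    · exact Or.inl (hx.trans hst)
    · exact Or.inr (Or.inl ⟨h1, h2.trans hst⟩)
    · exact Or.inr (Or.inr ⟨h1, h2.trans hst⟩)

/-- Exchange criterion. -/
theorem exchange_iff [DecidableEq ε] {T : Finset ε} (hT : IsSpanningTree ends T) {e f : ε}
    (he : e ∈ T) {x y : ν} (hxy : ends f = s(x, y)) :
    IsSpanningTree ends (insert f (T.erase e)) ↔ ¬ Reachable ends (T.erase e) x y := by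
  obtain ⟨a, b, hab⟩ : ∃ a b, ends e = s(a, b) := by
    induction h : ends e with
    | _ a b => exact ⟨a, b, rfl⟩
  have hnab : ¬ Reachable ends (T.erase e) a b := hT.1 e he a b hab
  constructor
  · intro h hr
    -- then everything is reachable in T.erase e
    apply hnab
    refine Reachable.ind (Q := fun w => Reachable ends (T.erase e) a w) ?_ (h.2 a b)
      (Reachable.refl a)
    intro g hg u v huv hu
    rcases Finset.mem_insert.1 hg with rfl | hg
    · rw [hxy] at huv
      rcases Sym2.eq_iff.1 huv with ⟨rfl, rfl⟩ | ⟨rfl, rfl⟩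
      · exact hu.trans hr
      · exact hu.trans hr.symm
    · exact hu.trans (Reachable.edge hg huv)
  · intro hr
    have hsub : T.erase e ⊆ insert f (T.erase e) := Finset.subset_insert _ _
    have hfE : Reachable ends (insert f (T.erase e)) x y :=
      Reachable.edge (Finset.mem_insert_self _ _) hxy
    have hside : ∀ w, Reachable ends (T.erase e) a w ∨ Reachable ends (T.erase e) b w := by
      intro w
      rcases Reachable.split hab (hT.2 a w) with h | h | h
      · exact Or.inl h
      · exact Or.inr h.2
      · exact Or.inl h.2
    have hab' : Reachable ends (insert f (T.erase e)) a b := by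
      rcases hside x with h1 | h1 <;> rcases hside y with h2 | h2
      · exact absurd (h1.symm.trans h2) hr
      · exact ((h1.mono hsub).trans hfE).trans (h2.mono hsub).symm
      · exact ((h2.mono hsub).trans hfE.symm).trans (h1.mono hsub).symm
      · exact absurd (h1.symm.trans h2) hr
    have hfT : f ∉ T.erase e := fun hf => hr (Reachable.edge hf hxy)
    refine ⟨?_, ?_⟩
    · intro g hg u v huv hreach
      rcases Finset.mem_insert.1 hg with rfl | hg
      · rw [Finset.erase_insert hfT] at hreach
        rw [hxy] at huv
        rcases Sym2.eq_iff.1 huv with ⟨rfl, rfl⟩ | ⟨rfl, rfl⟩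
        · exact hr hreach
        · exact hr hreach.symm
      · have hgT : g ∈ T := Finset.mem_of_mem_erase hg
        have hge : g ≠ e := (Finset.mem_erase.1 hg).1
        have e1 : ((insert f (T.erase e)).erase g).erase f ⊆ (T.erase g).erase e := by
          intro z; simp only [Finset.mem_erase, Finset.mem_insert]; tauto
        have e2 : (T.erase g).erase e ⊆ T.erase g := Finset.erase_subset _ _
        have e3 : (T.erase g).erase e ⊆ T.erase e := by
          intro z; simp only [Finset.mem_erase]; tauto
        have hu : Reachable ends (T.erase e) u v := Reachable.edge hg huv
        have key := hT.1 g hgT u v huv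
        rcases Reachable.split hxy hreach with h | ⟨h1, h2⟩ | ⟨h1, h2⟩
        · exact key ((h.mono e1).mono e2)
        · exact hr (((h1.mono e1).mono e3).symm.trans (hu.trans ((h2.mono e1).mono e3).symm))
        · exact hr ((((h1.mono e1).mono e3).symm.trans
            (hu.trans ((h2.mono e1).mono e3).symm)).symm)
    · intro u v
      refine Reachable.ind (Q := fun w => Reachable ends (insert f (T.erase e)) u w) ?_ (hT.2 u v)
        (Reachable.refl u)
      intro g hg p q hpq hp
      by_cases hge : g = e
      · subst hge
        rw [hab] at hpq
        rcases Sym2.eq_iff.1 hpq with ⟨rfl, rfl⟩ | ⟨rfl, rfl⟩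
        · exact hp.trans hab'
        · exact hp.trans hab'.symm
      · exact hp.trans (Reachable.edge
          (Finset.mem_insert_of_mem (Finset.mem_erase.2 ⟨hge, hg⟩)) hpq)

theorem mem_ends_iff {e : ε} {r : ν} : r ∈ ends e ↔ ∃ x, ends e = s(r, x) := by
  rw [Sym2.mem_iff_exists]

theorem Reachable.of_mem {e : ε} (he : e ∈ F) {u v : ν} (hu : u ∈ ends e) (hv : v ∈ ends e) :
    Reachable ends F u v := by
  obtain ⟨x, hx⟩ := mem_ends_iff.1 hu
  rw [hx] at hv
  rcases Sym2.mem_iff.1 hv with rfl | rfl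
  · exact Reachable.refl _
  · exact Reachable.edge he hx

/-- `e` is the first edge of the path from `r` to `t` in the forest `F`. -/
def FirstE [DecidableEq ε] (ends : ε → Sym2 ν) (F : Finset ε) (r t : ν) (e : ε) : Prop :=
  e ∈ F ∧ r ∈ ends e ∧ Reachable ends F r t ∧ ¬ Reachable ends (F.erase e) r t

variable [DecidableEq ε]

theorem FirstE.ne {r t : ν} {e : ε} (h : FirstE ends F r t e) : r ≠ t := by
  rintro rfl
  exact h.2.2.2 (Reachable.refl _)

theorem FirstE.other (hF : IsAcyclic ends F) {r t x : ν} {e : ε} (h : FirstE ends F r t e)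
    (hx : ends e = s(r, x)) : Reachable ends (F.erase e) x t := by
  rcases Reachable.split hx h.2.2.1 with h1 | h1 | h1
  · exact absurd h1 h.2.2.2
  · exact h1.2
  · exact absurd h1.1 (hF e h.1 r x hx)

theorem FirstE.unique (hF : IsAcyclic ends F) {r t : ν} {e e' : ε} (h : FirstE ends F r t e)
    (h' : FirstE ends F r t e') : e = e' := by
  by_contra hne
  obtain ⟨x, hx⟩ := mem_ends_iff.1 h.2.1
  obtain ⟨x', hx'⟩ := mem_ends_iff.1 h'.2.1
  have hxt := h.other hF hx
  have e2 : (F.erase e).erase e' ⊆ F.erase e' := by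
    intro z; simp only [Finset.mem_erase]; tauto
  have hrx : Reachable ends (F.erase e') r x :=
    Reachable.edge (Finset.mem_erase.2 ⟨hne, h.1⟩) hx
  rcases Reachable.split hx' hxt with h1 | h1 | h1
  · exact h'.2.2.2 (hrx.trans (h1.mono e2))
  · exact hF e h.1 r x hx (h1.1.of_erase).symm
  · exact h'.2.2.2 (h1.2.mono e2)

theorem FirstE.exists (hF : IsAcyclic ends F) {r t : ν} (hne : r ≠ t)
    (h : Reachable ends F r t) : ∃ e, FirstE ends F r t e := by
  have : t = r ∨ ∃ e, FirstE ends F r t e := by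
    refine Reachable.ind (Q := fun t => t = r ∨ ∃ e, FirstE ends F r t e) ?_ h (Or.inl rfl)
    intro f hf w w' hww hw
    by_cases hr : w' = r
    · exact Or.inl hr
    right
    rcases hw with rfl | ⟨e, he⟩
    · exact ⟨f, hf, by rw [hww]; exact Sym2.mem_mk_left _ _, Reachable.edge hf hww,
        hF f hf _ _ hww⟩
    · have hwr := he.ne
      have hfe : f ≠ e := by
        rintro rfl
        have := he.2.1
        rw [hww] at this
        rcases Sym2.mem_iff.1 this with h1 | h1
        · exact hwr h1
        · exact hr h1.symm
      refine ⟨e, he.1, he.2.1, he.2.2.1.trans (Reachable.edge hf hww), ?_⟩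
      intro h2
      exact he.2.2.2 (h2.trans (Reachable.edge (Finset.mem_erase.2 ⟨hfe, hf⟩) hww).symm)
  rcases this with h1 | h1
  · exact absurd h1.symm hne
  · exact h1

theorem FirstE.inj (hF : IsAcyclic ends F) {r r' t : ν} {e : ε} (h : FirstE ends F r t e)
    (h' : FirstE ends F r' t e) : r = r' := by
  by_contra hne
  obtain ⟨x, hx⟩ := mem_ends_iff.1 h.2.1
  have hr' := h'.2.1
  rw [hx] at hr'
  rcases Sym2.mem_iff.1 hr' with h1 | h1
  · exact hne h1.symm
  · subst h1
    exact h'.2.2.2 (h.other hF hx)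

theorem FirstE.surj (hF : IsAcyclic ends F) {v t : ν} {e : ε} (he : e ∈ F) (hv : v ∈ ends e)
    (h : Reachable ends F v t) : ∃ r, FirstE ends F r t e := by
  obtain ⟨x, hx⟩ := mem_ends_iff.1 hv
  by_cases h1 : Reachable ends (F.erase e) v t
  · refine ⟨x, he, by rw [hx]; exact Sym2.mem_mk_right _ _,
      (Reachable.edge he hx).symm.trans h, ?_⟩
    intro h2
    exact hF e he v x hx (h1.trans h2.symm)
  · exact ⟨v, he, hv, h, h1⟩

theorem FirstE.pair (hF : IsAcyclic ends F) {x y x' y' : ν} {e f : ε} (hef : e ≠ f)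
    (h1 : FirstE ends F x y e) (h2 : FirstE ends F y x f)
    (h1' : FirstE ends F x' y' e) (h2' : FirstE ends F y' x' f) : x = x' := by
  by_contra hne
  obtain ⟨z, hz⟩ := mem_ends_iff.1 h1.2.1
  have hx' := h1'.2.1
  rw [hz] at hx'
  rcases Sym2.mem_iff.1 hx' with h | h
  · exact hne h.symm
  · subst h
    have ha := h1.other hF hz
    have hb := h1'.other hF (by rw [hz, Sym2.eq_swap])
    have hc : Reachable ends (F.erase e) y y' :=
      Reachable.of_mem (Finset.mem_erase.2 ⟨hef.symm, h2.1⟩) h2.2.1 h2'.2.1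
    exact hF e h1.1 _ _ hz (hb.trans (hc.symm.trans ha.symm))

theorem FirstE.pair_eq {x y : ν} {e : ε}
    (h1 : FirstE ends F x y e) (h2 : FirstE ends F y x e) : ends e = s(x, y) :=
  (Sym2.mem_and_mem_iff h1.ne).1 ⟨h1.2.1, h2.2.1⟩

/-! ### Paths -/

namespace MWalk

theorem mem_support_of_mem_edges {u v : ν} (p : MWalk ends u v) {e : ε} (he : e ∈ p.edges)
    {x : ν} (hx : x ∈ ends e) : x ∈ p.support := by
  induction p with
  | nil u => simp [edges] at he
  | cons f v h p ih =>
    simp only [edges, List.mem_cons] at he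
    simp only [support, List.mem_cons]
    rcases he with rfl | he
    · rw [h] at hx
      rcases Sym2.mem_iff.1 hx with h1 | h1
      · exact Or.inl h1
      · right
        subst h1
        cases p <;> simp [support]
    · exact Or.inr (ih he)

theorem exists_suffix {u v : ν} (p : MWalk ends u v) {x : ν} (hx : x ∈ p.support)
    (hp : p.IsPath) (hF : p.edgesIn F) :
    ∃ q : MWalk ends x v, q.IsPath ∧ q.edgesIn F := by
  induction p with
  | nil u =>
    simp only [support, List.mem_singleton] at hx
    subst hx
    exact ⟨nil _, hp, hF⟩
  | cons f v h p ih =>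
    simp only [support, List.mem_cons] at hx
    rcases hx with rfl | hx
    · exact ⟨cons f v h p, hp, hF⟩
    · refine ih hx ?_ ?_
      · simp only [IsPath, support, List.nodup_cons] at hp
        exact hp.2
      · intro g hg
        exact hF g (by simp [edges, hg])

theorem exists_path {u v : ν} (h : Reachable ends F u v) :
    ∃ p : MWalk ends u v, p.IsPath ∧ p.edgesIn F := by
  obtain ⟨p, hp⟩ := h
  induction p with
  | nil u => exact ⟨nil u, by simp [IsPath, support], hp⟩
  | @cons u w e v h p ih =>
    obtain ⟨q, hq, hqF⟩ := ih (fun g hg => hp g (by simp [edges, hg]))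
    by_cases hu : u ∈ q.support
    · exact q.exists_suffix hu hq hqF
    · refine ⟨cons e v h q, ?_, ?_⟩
      · simp only [IsPath, support, List.nodup_cons]
        exact ⟨hu, hq⟩
      · intro g hg
        simp only [edges, List.mem_cons] at hg
        rcases hg with rfl | hg
        · exact hp g (by simp [edges])
        · exact hqF g hg

theorem odd_bridgeCount (sideF : ν → Bool) {u v : ν} (p : MWalk ends u v) :
    Odd (p.bridgeCount sideF) ↔ sideF u ≠ sideF v := by
  induction p with
  | nil u => simp [bridgeCount]
  | @cons u w e v h p ih =>
    simp only [bridgeCount]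
    split_ifs with h1
    · rw [h1, zero_add, ih]
    · rw [Nat.odd_add, ← Nat.not_odd_iff_even, ih]
      revert h1
      cases sideF u <;> cases sideF v <;> cases sideF w <;> simp

theorem first_of_head (hF : IsAcyclic ends F) {u v : ν} (p : MWalk ends u v) (hp : p.IsPath)
    (hpF : p.edgesIn F) {e : ε} (he : p.edges.head? = some e) : FirstE ends F u v e := by
  cases p with
  | nil u => simp [edges] at he
  | cons f w h q =>
    simp only [edges, List.head?_cons, Option.some.injEq] at he
    subst he
    simp only [IsPath, support, List.nodup_cons] at hp
    have hf : f ∈ F := hpF f (by simp [edges])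
    have hq : Reachable ends (F.erase f) w v := by
      refine ⟨q, fun g hg => Finset.mem_erase.2 ⟨?_, hpF g (by simp [edges, hg])⟩⟩
      rintro rfl
      exact hp.1 (q.mem_support_of_mem_edges hg (by rw [h]; exact Sym2.mem_mk_left _ _))
    refine ⟨hf, by rw [h]; exact Sym2.mem_mk_left _ _, ⟨_, hpF⟩, ?_⟩
    intro h2
    exact hF f hf _ _ h (h2.trans hq.symm)

theorem first_of_last (hF : IsAcyclic ends F) {u v : ν} (p : MWalk ends u v) (hp : p.IsPath)
    (hpF : p.edgesIn F) {e : ε} (he : p.edges.getLast? = some e) : FirstE ends F v u e := by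
  induction p with
  | nil u => simp [edges] at he
  | @cons u v f w h q ih =>
    have hhead := first_of_head hF _ hp hpF (e := f) (by simp [edges])
    have hf : f ∈ F := hpF f (by simp [edges])
    simp only [IsPath, support, List.nodup_cons] at hp
    have hne : f ∉ q.edges := fun hg =>
      hp.1 (q.mem_support_of_mem_edges hg (by rw [h]; exact Sym2.mem_mk_left _ _))
    by_cases hq : q.edges = []
    · cases q with
      | nil _ =>
        simp only [edges, List.getLast?_singleton, Option.some.injEq] at he
        subst he
        exact ⟨hf, by rw [h]; exact Sym2.mem_mk_right _ _, (Reachable.edge hf h).symm,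
          fun h2 => hF f hf _ _ h h2.symm⟩
      | cons _ _ _ _ => simp [edges] at hq
    · have he' : q.edges.getLast? = some e := by
        rw [edges, List.getLast?_cons_of_ne_nil hq] at he
        exact he
      have h1 := ih hp.2 (fun g hg => hpF g (by simp [edges, hg])) he'
      have hef : f ≠ e := by
        rintro rfl
        exact hne (List.mem_of_getLast? he')
      refine ⟨h1.1, h1.2.1, h1.2.2.1.trans (Reachable.edge hf h).symm, ?_⟩
      intro h2
      exact h1.2.2.2 (h2.trans (Reachable.edge (Finset.mem_erase.2 ⟨hef, hf⟩) h))

theorem edges_ne_nil {u v : ν} (p : MWalk ends u v) (h : u ≠ v) : p.edges ≠ [] := by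
  cases p with
  | nil _ => exact absurd rfl h
  | cons _ _ _ _ => simp [edges]

end MWalk

end General

/-! ### Structure of spanning trees of biconed graphs -/

namespace BiconedGraph

variable {P : BiconedGraph}

/-- The edge of `T₀` attached to a vertex of `G_red`. -/
def cV (P : BiconedGraph) : P.Vred → P.EB :=
  WithBot.recBotCoe P.e00 fun x => Sum.elim (fun a => P.eA a) (fun b => P.eB b) (ofLex x)

/-- The other endpoint of `cV r`. -/
def hub (P : BiconedGraph) : P.Vred → P.W :=
  WithBot.recBotCoe ⊥ fun x => Sum.elim (fun _ => ⊥) (fun _ => P.liftW ⊥) (ofLex x)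

theorem vred_cases {Q : P.Vred → Prop} (h0 : Q ⊥) (hA : ∀ a, Q (P.liftV (P.aVert a)))
    (hB : ∀ b, Q (P.liftV (P.bVert b))) (v : P.Vred) : Q v := by
  induction v using WithBot.recBotCoe with
  | bot => exact h0
  | coe x =>
    rcases x with a | b
    · exact hA a
    · exact hB b

@[simp] theorem cV_bot : P.cV ⊥ = P.e00 := rfl
@[simp] theorem cV_a (a) : P.cV (P.liftV (P.aVert a)) = P.eA a := rfl
@[simp] theorem cV_b (b) : P.cV (P.liftV (P.bVert b)) = P.eB b := rfl
@[simp] theorem hub_bot : P.hub ⊥ = ⊥ := rfl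
@[simp] theorem hub_a (a) : P.hub (P.liftV (P.aVert a)) = ⊥ := rfl
@[simp] theorem hub_b (b) : P.hub (P.liftV (P.bVert b)) = P.liftW ⊥ := rfl
@[simp] theorem side_bot : P.side ⊥ = false := rfl
@[simp] theorem side_a (a) : P.side (P.liftV (P.aVert a)) = true := rfl
@[simp] theorem side_b (b) : P.side (P.liftV (P.bVert b)) = false := rfl
@[simp] theorem liftV_ne_bot (x) : P.liftV x ≠ ⊥ := WithBot.coe_ne_bot
@[simp] theorem liftW_ne_bot (x) : P.liftW x ≠ ⊥ := WithBot.coe_ne_bot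
@[simp] theorem bot_ne_liftW (x) : ⊥ ≠ P.liftW x := WithBot.bot_ne_coe

theorem liftW_inj {x y : P.Vred} : P.liftW x = P.liftW y ↔ x = y := WithBot.coe_inj

theorem cV_injective : Function.Injective P.cV := by
  intro u
  refine vred_cases (Q := fun u => ∀ v, P.cV u = P.cV v → u = v) ?_ ?_ ?_ u
  · intro v
    refine vred_cases (Q := fun v => P.cV ⊥ = P.cV v → ⊥ = v) ?_ ?_ ?_ v <;> simp [e00, eA, eB]
  · intro a v
    refine vred_cases (Q := fun v => P.cV (P.liftV (P.aVert a)) = P.cV v →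
      P.liftV (P.aVert a) = v) ?_ ?_ ?_ v <;> simp +contextual [e00, eA, eB]
  · intro a v
    refine vred_cases (Q := fun v => P.cV (P.liftV (P.bVert a)) = P.cV v →
      P.liftV (P.bVert a) = v) ?_ ?_ ?_ v <;> simp +contextual [e00, eA, eB]

theorem redToEB_injective : Function.Injective P.redToEB := by
  intro u v h
  rcases u with u | u <;> rcases v with v | v <;> simp [redToEB, eS, eG] at h <;> simp [h]

theorem cV_ne_red (v : P.Vred) (f : P.Ered) : P.cV v ≠ P.redToEB f := by
  refine vred_cases (Q := fun v => P.cV v ≠ P.redToEB f) ?_ ?_ ?_ v <;>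
  rcases f with f | f <;> simp [redToEB, e00, eA, eB, eS, eG]

theorem eb_cases (e : P.EB) : (∃ v, e = P.cV v) ∨ ∃ f, e = P.redToEB f := by
  rcases e with u | a | b | s | e
  · exact Or.inl ⟨⊥, rfl⟩
  · exact Or.inl ⟨P.liftV (P.aVert a), rfl⟩
  · exact Or.inl ⟨P.liftV (P.bVert b), rfl⟩
  · exact Or.inr ⟨Sum.inl s, rfl⟩
  · exact Or.inr ⟨Sum.inr e, rfl⟩

theorem endsB_cV (v : P.Vred) : P.endsB (P.cV v) = s(P.hub v, P.liftW v) := by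
  refine vred_cases (Q := fun v => P.endsB (P.cV v) = s(P.hub v, P.liftW v)) ?_ ?_ ?_ v <;>
    intros <;> rfl

theorem endsB_red (f : P.Ered) : P.endsB (P.redToEB f) = (P.endsRed f).map P.liftW := by
  rcases f with f | f
  · rfl
  · simp only [redToEB, endsB, endsRed, Sym2.map_map]; rfl

theorem hub_cases (v : P.Vred) : (P.hub v = ⊥ ∧ (v = ⊥ ∨ P.side v = true)) ∨
    (P.hub v = P.liftW ⊥ ∧ v ≠ ⊥ ∧ P.side v = false) := by
  refine vred_cases (Q := fun v => (P.hub v = ⊥ ∧ (v = ⊥ ∨ P.side v = true)) ∨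
    (P.hub v = P.liftW ⊥ ∧ v ≠ ⊥ ∧ P.side v = false)) ?_ ?_ ?_ v <;> simp

theorem hub_of_true {v : P.Vred} (h : P.side v = true) : P.hub v = ⊥ := by
  rcases hub_cases v with h1 | h1
  · exact h1.1
  · rw [h] at h1; simp at h1

theorem hub_of_false {v : P.Vred} (h : P.side v = false) (hv : v ≠ ⊥) :
    P.hub v = P.liftW ⊥ := by
  rcases hub_cases v with h1 | h1
  · rw [h] at h1; simp [hv] at h1
  · exact h1.1

/-- Reachability in the reduced forest of `T`. -/
abbrev RR (T : Finset P.EB) (u v : P.Vred) : Prop := Reachable P.endsRed (P.redOf T) u v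

/-- Roots: `0̄` and the connecting vertices of `T`. -/
def Rt (T : Finset P.EB) (v : P.Vred) : Prop := v = ⊥ ∨ P.cV v ∈ T

theorem Rt_bot (T : Finset P.EB) : Rt T (⊥ : P.Vred) := Or.inl rfl

theorem mem_redOf {T : Finset P.EB} {f : P.Ered} : f ∈ P.redOf T ↔ P.redToEB f ∈ T := by
  simp [redOf]

theorem RR.lift {T : Finset P.EB} {u v : P.Vred} (h : RR T u v) :
    Reachable P.endsB T (P.liftW u) (P.liftW v) := by
  refine Reachable.ind (Q := fun v => Reachable P.endsB T (P.liftW u) (P.liftW v)) ?_ h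
    (Reachable.refl _)
  intro e he a b hab ha
  refine ha.trans (Reachable.edge (mem_redOf.1 he) ?_)
  rw [endsB_red, hab]; rfl

theorem redOf_erase_cV (T : Finset P.EB) (v : P.Vred) : P.redOf (T.erase (P.cV v)) = P.redOf T := by
  ext f
  simp only [mem_redOf, Finset.mem_erase]
  exact ⟨fun h => h.2, fun h => ⟨(cV_ne_red v f).symm, h⟩⟩

theorem redOf_erase_red (T : Finset P.EB) (f : P.Ered) :
    P.redOf (T.erase (P.redToEB f)) = (P.redOf T).erase f := by
  ext g
  simp only [mem_redOf, Finset.mem_erase, ne_eq, redToEB_injective.eq_iff]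

theorem cut_one {T : Finset P.EB} {v : P.Vred} (h : ∀ r, Rt T r → ¬ RR T v r) {w : P.W}
    (hw : Reachable P.endsB T (P.liftW v) w) : ∃ u, w = P.liftW u ∧ RR T v u := by
  refine Reachable.ind (Q := fun w => ∃ u, w = P.liftW u ∧ RR T v u) ?_ hw
    ⟨v, rfl, Reachable.refl _⟩
  rintro e he a b hab ⟨u, rfl, hu⟩
  rcases eb_cases e with ⟨r, rfl⟩ | ⟨f, rfl⟩
  · exfalso
    rw [endsB_cV] at hab
    rcases Sym2.eq_iff.1 hab with ⟨h1, h2⟩ | ⟨h1, h2⟩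
    · rcases hub_cases r with h3 | h3
      · rw [h3.1] at h1; simp at h1
      · rw [h3.1, liftW_inj] at h1
        subst h1
        exact h _ (Rt_bot T) hu
    · rw [liftW_inj] at h2
      subst h2
      exact h _ (Or.inr he) hu
  · rw [endsB_red] at hab
    induction hf : P.endsRed f with
    | _ x y =>
      rw [hf, Sym2.map_mk] at hab
      have hxy := Reachable.edge (mem_redOf.2 he) hf
      rcases Sym2.eq_iff.1 hab with ⟨h1, h2⟩ | ⟨h1, h2⟩
      · simp only [liftW_inj] at h1
        subst h1
        exact ⟨y, h2.symm, hu.trans hxy⟩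
      · simp only [liftW_inj] at h2
        subst h2
        exact ⟨x, h1.symm, hu.trans hxy.symm⟩

theorem cut_two {T : Finset P.EB} (h0 : P.e00 ∉ T)
    (h : ∀ r s, Rt T r → Rt T s → P.side r = true → P.side s = false → ¬ RR T r s) {w : P.W}
    (hw : Reachable P.endsB T ⊥ w) :
    w = ⊥ ∨ ∃ u r, w = P.liftW u ∧ Rt T r ∧ P.side r = true ∧ RR T r u := by
  refine Reachable.ind (Q := fun w => w = ⊥ ∨ ∃ u r, w = P.liftW u ∧ Rt T r ∧
    P.side r = true ∧ RR T r u) ?_ hw (Or.inl rfl)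
  rintro e he a b hab hu
  rcases eb_cases e with ⟨r, rfl⟩ | ⟨f, rfl⟩
  · have hr : r ≠ ⊥ := by rintro rfl; exact h0 he
    rw [endsB_cV] at hab
    rcases hub_cases r with h3 | h3
    · have hs : P.side r = true := by rcases h3.2 with h | h; exact absurd h hr; exact h
      rw [h3.1] at hab
      rcases Sym2.eq_iff.1 hab with ⟨h1, h2⟩ | ⟨h1, h2⟩
      · exact Or.inr ⟨r, r, h2.symm, Or.inr he, hs, Reachable.refl _⟩
      · exact Or.inl h1.symm
    · exfalso
      rw [h3.1] at hab
      rcases Sym2.eq_iff.1 hab with ⟨h1, h2⟩ | ⟨h1, h2⟩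
      · subst h1
        rcases hu with hu | ⟨u, s, hu1, hu2, hu3, hu4⟩
        · simp at hu
        · rw [liftW_inj] at hu1
          subst hu1
          exact h _ _ hu2 (Rt_bot T) hu3 rfl hu4
      · subst h2
        rcases hu with hu | ⟨u, s, hu1, hu2, hu3, hu4⟩
        · simp at hu
        · rw [liftW_inj] at hu1
          subst hu1
          exact h _ _ hu2 (Or.inr he) hu3 h3.2.2 hu4
  · rw [endsB_red] at hab
    induction hf : P.endsRed f with
    | _ x y =>
      rw [hf, Sym2.map_mk] at hab
      have hxy := Reachable.edge (mem_redOf.2 he) hf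
      rcases Sym2.eq_iff.1 hab with ⟨h1, h2⟩ | ⟨h1, h2⟩
      · subst h1
        rcases hu with hu | ⟨u, s, hu1, hu2, hu3, hu4⟩
        · simp at hu
        · rw [liftW_inj] at hu1
          subst hu1
          exact Or.inr ⟨y, s, h2.symm, hu2, hu3, hu4.trans hxy⟩
      · subst h2
        rcases hu with hu | ⟨u, s, hu1, hu2, hu3, hu4⟩
        · simp at hu
        · rw [liftW_inj] at hu1
          subst hu1
          exact Or.inr ⟨x, s, h1.symm, hu2, hu3, hu4.trans hxy.symm⟩

/-- Combinatorial description of spanning trees. -/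
structure Good (T : Finset P.EB) : Prop where
  acyc : IsAcyclic P.endsRed (P.redOf T)
  root : ∀ v, ∃ r, Rt T r ∧ RR T v r
  sides : ∀ r s, Rt T r → Rt T s → r ≠ s → RR T r s → P.side r ≠ P.side s ∧ P.e00 ∉ T
  uniq : ∀ r s r' s', Rt T r → Rt T s → r ≠ s → RR T r s →
    Rt T r' → Rt T s' → r' ≠ s' → RR T r' s' → RR T r r'
  exi : P.e00 ∉ T → ∃ r s, Rt T r ∧ Rt T s ∧ r ≠ s ∧ RR T r s

theorem Rt.edge {T T' : Finset P.EB} {r : P.Vred} (h : Rt T r) (h' : r ≠ ⊥ → P.cV r ∈ T → P.cV r ∈ T')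
    (hs : P.side r = true) : Reachable P.endsB T' (P.liftW r) ⊥ := by
  have hr : r ≠ ⊥ := by rintro rfl; simp at hs
  have h1 : P.cV r ∈ T' := h' hr (h.resolve_left hr)
  refine (Reachable.edge h1 ?_).symm
  rw [endsB_cV, hub_of_true hs]

theorem Rt.edge' {T T' : Finset P.EB} {r : P.Vred} (h : Rt T r) (h' : r ≠ ⊥ → P.cV r ∈ T → P.cV r ∈ T')
    (hs : P.side r = false) : Reachable P.endsB T' (P.liftW r) (P.liftW ⊥) := by
  by_cases hr : r = ⊥
  · subst hr; exact Reachable.refl _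
  have h1 : P.cV r ∈ T' := h' hr (h.resolve_left hr)
  refine (Reachable.edge h1 ?_).symm
  rw [endsB_cV, hub_of_false hs hr]

theorem good_of_tree {T : Finset P.EB} (hT : IsSpanningTree P.endsB T) : Good T := by
  -- key: two connected roots are on different sides
  have lift' : ∀ (r u v : P.Vred), RR T u v →
      Reachable P.endsB (T.erase (P.cV r)) (P.liftW u) (P.liftW v) := by
    intro r u v h
    apply RR.lift
    rw [RR, redOf_erase_cV]; exact h
  have key : ∀ r, P.cV r ∈ T → ¬ Reachable P.endsB (T.erase (P.cV r)) (P.liftW r) (P.hub r) :=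
    fun r hr h => hT.1 _ hr _ _ (by rw [endsB_cV]) h.symm
  have mem' : ∀ {r s : P.Vred}, r ≠ s → P.cV s ∈ T → P.cV s ∈ T.erase (P.cV r) := by
    intro r s hrs hs
    exact Finset.mem_erase.2 ⟨fun h => hrs (cV_injective h).symm, hs⟩
  have k1 : ∀ r s, Rt T r → Rt T s → r ≠ s → RR T r s → P.side r ≠ P.side s := by
    intro r s hr hs hrs hrr he
    wlog hr0 : r ≠ ⊥ generalizing r s with H
    · rw [not_not] at hr0
      exact H s r hs hr hrs.symm hrr.symm he.symm (by rw [← hr0]; exact hrs.symm)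
    have hrT := hr.resolve_left hr0
    apply key r hrT
    refine (lift' r r s hrr).trans ?_
    by_cases hsd : P.side r = true
    · rw [hub_of_true hsd]
      exact hs.edge (fun _ h => mem' hrs h) (by rw [← he]; exact hsd)
    · simp only [Bool.not_eq_true] at hsd
      rw [hub_of_false hsd hr0]
      exact hs.edge' (fun _ h => mem' hrs h) (by rw [← he]; exact hsd)
  have k2 : ∀ r s, Rt T r → Rt T s → RR T r s → P.side r = true → P.side s = false →
      P.e00 ∉ T := by
    intro r s hr hs hrr h1 h2 he
    have hrs : r ≠ s := by rintro rfl; rw [h1] at h2; simp at h2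
    have hr0 : r ≠ ⊥ := by rintro rfl; simp at h1
    apply key r (hr.resolve_left hr0)
    rw [hub_of_true h1]
    refine ((lift' r r s hrr).trans (hs.edge' (fun _ h => mem' hrs h) h2)).trans ?_
    exact (Reachable.edge (mem' hr0 (s := ⊥) he) (endsB_cV _)).symm
  have k3 : ∀ r s r' s', Rt T r → Rt T s → RR T r s → P.side r = true → P.side s = false →
      Rt T r' → Rt T s' → RR T r' s' → P.side r' = true → P.side s' = false → RR T r r' := by
    intro r s r' s' hr hs hrr h1 h2 hr' hs' hrr' h1' h2'
    by_contra hcon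
    have ne : ∀ {x y : P.Vred}, P.side x = true → P.side y = false → x ≠ y := by
      rintro x y h1 h2 rfl; rw [h1] at h2; simp at h2
    have hne : r ≠ r' := by rintro rfl; exact hcon (Reachable.refl _)
    apply key r (hr.resolve_left (ne h1 rfl))
    rw [hub_of_true h1]
    refine (lift' r r s hrr).trans ((hs.edge' (fun _ h => mem' (ne h1 h2) h) h2).trans ?_)
    refine ((hs'.edge' (fun _ h => mem' (ne h1 h2') h) h2').symm).trans ?_
    exact (lift' r s' r' hrr'.symm).trans (hr'.edge (fun _ h => mem' hne h) h1')
  refine ⟨?_, ?_, ?_, ?_, ?_⟩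
  · intro e he u v huv hr
    refine hT.1 _ (mem_redOf.1 he) (P.liftW u) (P.liftW v) (by rw [endsB_red, huv]; rfl) ?_
    apply RR.lift
    rw [RR, redOf_erase_red]; exact hr
  · intro v
    by_contra hcon
    push Not at hcon
    obtain ⟨u, hu, -⟩ := cut_one hcon (hT.2 (P.liftW v) ⊥)
    simp at hu
  · intro r s hr hs hrs hrr
    have hk := k1 r s hr hs hrs hrr
    refine ⟨hk, ?_⟩
    cases h1 : P.side r <;> cases h2 : P.side s
    · rw [h1, h2] at hk; exact absurd rfl hk
    · exact k2 s r hs hr hrr.symm h2 h1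
    · exact k2 r s hr hs hrr h1 h2
    · rw [h1, h2] at hk; exact absurd rfl hk
  · intro r s r' s' hr hs hrs hrr hr' hs' hrs' hrr'
    have hk := k1 r s hr hs hrs hrr
    have hk' := k1 r' s' hr' hs' hrs' hrr'
    cases h1 : P.side r <;> cases h2 : P.side s <;> cases h3 : P.side r' <;>
      cases h4 : P.side s' <;> simp only [h1, h2, h3, h4, ne_eq, not_true_eq_false] at hk hk'
    · exact hrr.trans ((k3 s r s' r' hs hr hrr.symm h2 h1 hs' hr' hrr'.symm h4 h3).trans hrr'.symm)
    · exact hrr.trans (k3 s r r' s' hs hr hrr.symm h2 h1 hr' hs' hrr' h3 h4)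
    · exact (k3 r s s' r' hr hs hrr h1 h2 hs' hr' hrr'.symm h4 h3).trans hrr'.symm
    · exact k3 r s r' s' hr hs hrr h1 h2 hr' hs' hrr' h3 h4
  · intro h0
    by_contra hcon
    push Not at hcon
    have : ∀ r s, Rt T r → Rt T s → P.side r = true → P.side s = false → ¬ RR T r s := by
      intro r s hr hs h1 h2
      exact hcon r s hr hs (by rintro rfl; rw [h1] at h2; simp at h2)
    rcases cut_two h0 this (hT.2 ⊥ (P.liftW ⊥)) with h | ⟨u, r, h1, h2, h3, h4⟩
    · simp at h
    · rw [liftW_inj] at h1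
      subst h1
      exact this r ⊥ h2 (Rt_bot T) h3 rfl h4

end BiconedGraph

namespace BiconedGraph

variable {P : BiconedGraph}

theorem Good.three {T : Finset P.EB} (h : Good T) {r s t : P.Vred} (hr : Rt T r) (hs : Rt T s)
    (ht : Rt T t) (h1 : RR T r s) (h2 : RR T r t) (hrs : r ≠ s) : t = r ∨ t = s := by
  by_contra hcon
  push Not at hcon
  have a1 := (h.sides r s hr hs hrs h1).1
  have a2 := (h.sides t r ht hr hcon.1 h2.symm).1
  have a3 := (h.sides t s ht hs hcon.2 (h2.symm.trans h1)).1
  revert a1 a2 a3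
  cases P.side r <;> cases P.side s <;> cases P.side t <;> simp

theorem no_conn {T : Finset P.EB} (h0 : P.e00 ∉ T)
    (h : ∀ r s, Rt T r → Rt T s → P.side r = true → P.side s = false → ¬ RR T r s) :
    ¬ Reachable P.endsB T ⊥ (P.liftW ⊥) := by
  intro hr
  rcases cut_two h0 h hr with h1 | ⟨u, r, h1, h2, h3, h4⟩
  · simp at h1
  · rw [liftW_inj] at h1
    subst h1
    exact h r ⊥ h2 (Rt_bot T) h3 rfl h4

theorem Rt.of_erase {T : Finset P.EB} {r s : P.Vred} (h : Rt (T.erase (P.cV r)) s) : Rt T s :=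
  h.imp id Finset.mem_of_mem_erase

theorem Rt.ne_of_erase {T : Finset P.EB} {r s : P.Vred} (h : Rt (T.erase (P.cV r)) s)
    (hr : r ≠ ⊥) : s ≠ r := by
  rintro rfl
  rcases h with h | h
  · exact hr h
  · simp at h

theorem mem_erase_cV {T : Finset P.EB} {r s : P.Vred} (hrs : s ≠ r) (hs : P.cV s ∈ T) :
    P.cV s ∈ T.erase (P.cV r) :=
  Finset.mem_erase.2 ⟨fun h => hrs (cV_injective h), hs⟩

theorem Good.no_conn {T : Finset P.EB} (h : Good T) {r s : P.Vred} (hr : Rt T r) (hr0 : r ≠ ⊥)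
    (hs : Rt T s) (hrs : r ≠ s) (hrr : RR T r s) :
    ¬ Reachable P.endsB (T.erase (P.cV r)) ⊥ (P.liftW ⊥) := by
  have hsd := h.sides r s hr hs hrs hrr
  apply BiconedGraph.no_conn
  · intro h1
    exact hsd.2 (Finset.mem_of_mem_erase h1)
  · intro r' s' hr' hs' h1 h2 h3
    rw [RR, redOf_erase_cV] at h3
    have hne : r' ≠ s' := by rintro rfl; rw [h1] at h2; simp at h2
    have h4 := h.uniq r s r' s' hr hs hrs hrr hr'.of_erase hs'.of_erase hne h3
    rcases h.three hr'.of_erase hs'.of_erase hr h3 h4.symm hne with h5 | h5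
    · exact hr'.ne_of_erase hr0 h5.symm
    · exact hs'.ne_of_erase hr0 h5.symm

theorem Good.cut {T : Finset P.EB} {r : P.Vred} (hr0 : r ≠ ⊥)
    (hno : ∀ s, Rt T s → s ≠ r → ¬ RR T r s) {w : P.W}
    (hw : Reachable P.endsB (T.erase (P.cV r)) (P.liftW r) w) :
    ∃ u, w = P.liftW u ∧ RR T r u := by
  have := cut_one (T := T.erase (P.cV r)) (v := r) ?_ hw
  · simpa only [RR, redOf_erase_cV] using this
  · intro s hs
    rw [RR, redOf_erase_cV]
    exact hno s hs.of_erase (hs.ne_of_erase hr0)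

theorem not_reach_hub {T : Finset P.EB} {r v : P.Vred} (hr0 : r ≠ ⊥)
    (hno : ∀ s, Rt T s → s ≠ r → ¬ RR T r s) :
    ¬ Reachable P.endsB (T.erase (P.cV r)) (P.liftW r) (P.hub v) := by
  intro hw
  obtain ⟨u, h1, h2⟩ := Good.cut hr0 hno hw
  rcases hub_cases v with h3 | h3
  · rw [h3.1] at h1; simp at h1
  · rw [h3.1, liftW_inj] at h1
    subst h1
    exact hno ⊥ (Rt_bot T) hr0.symm h2

theorem w_cases (w : P.W) : w = ⊥ ∨ ∃ v, w = P.liftW v := by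
  induction w using WithBot.recBotCoe with
  | bot => exact Or.inl rfl
  | coe x => exact Or.inr ⟨x, rfl⟩

theorem tree_of_good {T : Finset P.EB} (h : Good T) : IsSpanningTree P.endsB T := by
  constructor
  · have main : ∀ e ∈ T, ∃ a b, P.endsB e = s(a, b) ∧ ¬ Reachable P.endsB (T.erase e) a b := by
      intro e he
      rcases eb_cases e with ⟨r, rfl⟩ | ⟨f, rfl⟩
      · refine ⟨_, _, endsB_cV r, ?_⟩
        by_cases hr0 : r = ⊥
        · subst hr0
          apply no_conn
          · simp
          · intro r' s' hr' hs' h1 h2 h3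
            rw [RR, redOf_erase_cV] at h3
            exact (h.sides r' s' hr'.of_erase hs'.of_erase
              (by rintro rfl; rw [h1] at h2; simp at h2) h3).2 he
        by_cases hs : ∃ s, Rt T s ∧ s ≠ r ∧ RR T r s
        · obtain ⟨s, hs, hsr, hrr⟩ := hs
          have hsd := h.sides r s (Or.inr he) hs hsr.symm hrr
          have hnc := h.no_conn (Or.inr he) hr0 hs hsr.symm hrr
          have hl : Reachable P.endsB (T.erase (P.cV r)) (P.liftW r) (P.liftW s) := by
            apply RR.lift; rw [RR, redOf_erase_cV]; exact hrr
          intro hreach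
          cases h1 : P.side r
          · rw [hub_of_false h1 hr0] at hreach
            have h2 : P.side s = true := by
              rw [h1] at hsd; cases h2 : P.side s
              · rw [h2] at hsd; exact absurd rfl hsd.1
              · rfl
            exact hnc ((hreach.trans hl).trans (hs.edge (fun _ => mem_erase_cV hsr) h2)).symm
          · rw [hub_of_true h1] at hreach
            have h2 : P.side s = false := by
              rw [h1] at hsd; cases h2 : P.side s
              · rfl
              · rw [h2] at hsd; exact absurd rfl hsd.1
            exact hnc ((hreach.trans hl).trans (hs.edge' (fun _ => mem_erase_cV hsr) h2))
        · push Not at hs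
          intro hreach
          exact not_reach_hub hr0 hs hreach.symm
      · obtain ⟨u, v, huv⟩ : ∃ a b, P.endsRed f = s(a, b) := by
          induction h : P.endsRed f with
          | _ a b => exact ⟨a, b, rfl⟩
        refine ⟨P.liftW u, P.liftW v, by rw [endsB_red, huv]; rfl, ?_⟩
        intro hreach
        have hf := mem_redOf.2 he
        have hac := h.acyc f hf u v huv
        have hRt : ∀ r, Rt (T.erase (P.redToEB f)) r ↔ Rt T r := by
          intro r
          simp only [Rt, Finset.mem_erase, ne_eq, cV_ne_red, not_false_eq_true, true_and]
        have hRR : ∀ a b, RR (T.erase (P.redToEB f)) a b ↔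
            Reachable P.endsRed ((P.redOf T).erase f) a b := by
          intro a b; rw [RR, redOf_erase_red]
        have hru : ∃ r, Rt T r ∧ RR (T.erase (P.redToEB f)) u r := by
          by_contra hcon
          push Not at hcon
          obtain ⟨w, h1, h2⟩ := cut_one (T := T.erase (P.redToEB f)) (v := u)
            (fun r hr => hcon r ((hRt r).1 hr)) hreach
          rw [liftW_inj] at h1
          subst h1
          exact hac ((hRR _ _).1 h2)
        have hrv : ∃ r, Rt T r ∧ RR (T.erase (P.redToEB f)) v r := by
          by_contra hcon
          push Not at hcon
          obtain ⟨w, h1, h2⟩ := cut_one (T := T.erase (P.redToEB f)) (v := v)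
            (fun r hr => hcon r ((hRt r).1 hr)) hreach.symm
          rw [liftW_inj] at h1
          subst h1
          exact hac ((hRR _ _).1 h2).symm
        obtain ⟨ru, hru, hru'⟩ := hru
        obtain ⟨rv, hrv, hrv'⟩ := hrv
        have hnr : ¬ RR (T.erase (P.redToEB f)) ru rv := fun h1 =>
          hac ((hRR _ _).1 (hru'.trans (h1.trans hrv'.symm)))
        have hne : ru ≠ rv := by rintro rfl; exact hnr (Reachable.refl _)
        have hRR' : ∀ {a b}, RR (T.erase (P.redToEB f)) a b → RR T a b := fun h1 =>
          ((hRR _ _).1 h1).of_erase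
        have hrr : RR T ru rv :=
          (hRR' hru').symm.trans ((Reachable.edge hf huv).trans (hRR' hrv'))
        have hsd := h.sides ru rv hru hrv hne hrr
        have hnc : ¬ Reachable P.endsB (T.erase (P.redToEB f)) ⊥ (P.liftW ⊥) := by
          apply no_conn
          · intro h1
            exact hsd.2 (Finset.mem_of_mem_erase h1)
          · intro r' s' hr' hs' h1 h2 h3
            rw [hRt] at hr' hs'
            have hne' : r' ≠ s' := by rintro rfl; rw [h1] at h2; simp at h2
            have h4 := h.uniq ru rv r' s' hru hrv hne hrr hr' hs' hne' (hRR' h3)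
            rcases h.three hru hrv hr' hrr h4 hne with rfl | rfl <;>
            rcases h.three hru hrv hs' hrr (h4.trans (hRR' h3)) hne with rfl | rfl
            · exact hne' rfl
            · exact hnr h3
            · exact hnr h3.symm
            · exact hne' rfl
        have hmem : ∀ r : P.Vred, r ≠ ⊥ → P.cV r ∈ T → P.cV r ∈ T.erase (P.redToEB f) :=
          fun r _ h1 => Finset.mem_erase.2 ⟨cV_ne_red _ _, h1⟩
        have hconn : Reachable P.endsB (T.erase (P.redToEB f)) (P.liftW ru) (P.liftW rv) :=
          (hru'.lift).symm.trans (hreach.trans hrv'.lift)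
        cases h1 : P.side ru <;> cases h2 : P.side rv
        · rw [h1, h2] at hsd; exact hsd.1 rfl
        · exact hnc ((hrv.edge (hmem rv) h2).symm.trans (hconn.symm.trans (hru.edge' (hmem ru) h1)))
        · exact hnc ((hru.edge (hmem ru) h1).symm.trans (hconn.trans (hrv.edge' (hmem rv) h2)))
        · rw [h1, h2] at hsd; exact hsd.1 rfl
    intro e he u v huv hr
    obtain ⟨a, b, hab, hn⟩ := main e he
    rw [hab] at huv
    rcases Sym2.eq_iff.1 huv with ⟨rfl, rfl⟩ | ⟨rfl, rfl⟩
    · exact hn hr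
    · exact hn hr.symm
  · have h00 : Reachable P.endsB T (P.liftW ⊥) ⊥ := by
      by_cases h0 : P.e00 ∈ T
      · exact (Reachable.edge h0 (endsB_cV ⊥)).symm
      · obtain ⟨r, s, hr, hs, hne, hrr⟩ := h.exi h0
        have hsd := (h.sides r s hr hs hne hrr).1
        have hl := hrr.lift
        cases h1 : P.side r <;> cases h2 : P.side s
        · rw [h1, h2] at hsd; exact absurd rfl hsd
        · exact (hr.edge' (fun _ h => h) h1).symm.trans (hl.trans (hs.edge (fun _ h => h) h2))
        · exact (hs.edge' (fun _ h => h) h2).symm.trans (hl.symm.trans (hr.edge (fun _ h => h) h1))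
        · rw [h1, h2] at hsd; exact absurd rfl hsd
    have hall : ∀ w, Reachable P.endsB T w ⊥ := by
      intro w
      rcases w_cases w with rfl | ⟨v, rfl⟩
      · exact Reachable.refl _
      · obtain ⟨r, hr, hvr⟩ := h.root v
        refine hvr.lift.trans ?_
        cases h1 : P.side r
        · exact (hr.edge' (fun _ h => h) h1).trans h00
        · exact hr.edge (fun _ h => h) h1
    intro u v
    exact (hall u).trans (hall v).symm

/-! ### The target of a root -/

/-- The minimum of the component of `v`. -/
def mn (F : Finset P.Ered) (v : P.Vred) : P.Vred :=
  (Finset.univ.filter fun u => Reachable P.endsRed F v u).min'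
    ⟨v, by simp [Reachable.refl]⟩

theorem mn_reach (F : Finset P.Ered) (v : P.Vred) : Reachable P.endsRed F v (mn F v) := by
  have := Finset.min'_mem (Finset.univ.filter fun u => Reachable P.endsRed F v u)
    ⟨v, by simp [Reachable.refl]⟩
  exact (Finset.mem_filter.1 this).2

theorem mn_le {F : Finset P.Ered} {v u : P.Vred} (h : Reachable P.endsRed F v u) :
    mn F v ≤ u := Finset.min'_le _ _ (by simp [h])

theorem mn_congr {F : Finset P.Ered} {v u : P.Vred} (h : Reachable P.endsRed F v u) :
    mn F v = mn F u :=
  le_antisymm (mn_le (h.trans (mn_reach F u))) (mn_le (h.symm.trans (mn_reach F v)))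

theorem mn_bot {F : Finset P.Ered} {v : P.Vred} (h : Reachable P.endsRed F v ⊥) :
    mn F v = ⊥ := le_antisymm (mn_le h) bot_le

/-- The target of a root: the other root in its component, or else the minimum. -/
def tgt (T : Finset P.EB) (r : P.Vred) : P.Vred :=
  if h : ∃ s, Rt T s ∧ s ≠ r ∧ RR T r s then Classical.choose h else mn (P.redOf T) r

theorem tgt_reach (T : Finset P.EB) (r : P.Vred) : RR T r (tgt T r) := by
  unfold tgt
  split_ifs with h
  · exact (Classical.choose_spec h).2.2
  · exact mn_reach _ _

theorem Good.tgt_eq {T : Finset P.EB} (h : Good T) {r s : P.Vred} (hr : Rt T r) (hs : Rt T s)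
    (hsr : s ≠ r) (hrr : RR T r s) : tgt T r = s := by
  have hex : ∃ s, Rt T s ∧ s ≠ r ∧ RR T r s := ⟨s, hs, hsr, hrr⟩
  unfold tgt
  rw [dif_pos hex]
  obtain ⟨h1, h2, h3⟩ := Classical.choose_spec hex
  rcases h.three hr hs h1 hrr h3 hsr.symm with h4 | h4
  · exact absurd h4 h2
  · exact h4

theorem tgt_eq_mn {T : Finset P.EB} {r : P.Vred} (hno : ∀ s, Rt T s → s ≠ r → ¬ RR T r s) :
    tgt T r = mn (P.redOf T) r := by
  unfold tgt
  rw [dif_neg]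
  push Not
  exact hno

end BiconedGraph

/-! ### Internal passivity -/

namespace BiconedGraph

variable {P : BiconedGraph}

theorem lt_of_side {u v : P.Vred} (hu : P.side u = true) (hv : P.side v = false) (hv0 : v ≠ ⊥) :
    u < v := by
  revert hu
  refine vred_cases (Q := fun u => P.side u = true → u < v) ?_ ?_ ?_ u
  · simp
  · intro a _
    revert hv hv0
    refine vred_cases (Q := fun v => P.side v = false → v ≠ ⊥ → P.liftV (P.aVert a) < v) ?_ ?_ ?_ v
    · simp
    · simp
    · intro b _ _
      exact WithBot.coe_lt_coe.2 (Sum.Lex.inl_lt_inr a b)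
  · simp

theorem hub_le (v : P.Vred) : P.hub v ≤ P.liftW v := by
  rcases hub_cases v with h | h
  · rw [h.1]; exact bot_le
  · rw [h.1]; exact WithBot.coe_le_coe.2 bot_le

theorem hub_mono {u v : P.Vred} (h : u ≤ v) : P.hub u ≤ P.hub v := by
  rcases hub_cases u with h1 | h1
  · rw [h1.1]; exact bot_le
  · rcases hub_cases v with h2 | h2
    · exfalso
      rcases h2.2 with rfl | h3
      · exact h1.2.1 (le_bot_iff.1 h)
      · exact absurd h (not_le_of_gt (lt_of_side h3 h1.2.2 h1.2.1))
    · rw [h1.1, h2.1]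

theorem lexEnds_cV (v : P.Vred) : P.lexEnds (P.cV v) = toLex (P.hub v, P.liftW v) := by
  unfold lexEnds endMin endMax
  rw [endsB_cV]
  simp only [Sym2.lift_mk]
  rw [inf_eq_left.2 (hub_le v), sup_eq_right.2 (hub_le v)]

theorem lexEnds_red {f : P.Ered} {x y : P.Vred} (h : P.endsRed f = s(x, y)) :
    P.lexEnds (P.redToEB f) = toLex (P.liftW (x ⊓ y), P.liftW (x ⊔ y)) := by
  unfold lexEnds endMin endMax
  rw [endsB_red, h]
  simp only [Sym2.map_mk, Sym2.lift_mk]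
  rfl

theorem lexEnds_mono {u v : P.Vred} (h : u < v) : P.lexEnds (P.cV u) < P.lexEnds (P.cV v) := by
  rw [lexEnds_cV, lexEnds_cV, Prod.Lex.toLex_lt_toLex]
  rcases (hub_mono h.le).lt_or_eq with h1 | h1
  · exact Or.inl h1
  · exact Or.inr ⟨h1, WithBot.coe_lt_coe.2 h⟩

theorem lexEnds_lt_red {f : P.Ered} {u x y : P.Vred} (h : P.endsRed f = s(x, y))
    (hu : P.hub u = ⊥) : P.lexEnds (P.cV u) < P.lexEnds (P.redToEB f) := by
  rw [lexEnds_cV, lexEnds_red h, Prod.Lex.toLex_lt_toLex, hu]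
  exact Or.inl (WithBot.bot_lt_coe _)

theorem lexEnds_lt_red' {f : P.Ered} {u x y : P.Vred} (h : P.endsRed f = s(x, y))
    (hu : P.hub u = P.liftW ⊥) (hx : x ≠ ⊥) (hy : y ≠ ⊥) :
    P.lexEnds (P.cV u) < P.lexEnds (P.redToEB f) := by
  rw [lexEnds_cV, lexEnds_red h, Prod.Lex.toLex_lt_toLex, hu]
  refine Or.inl (WithBot.coe_lt_coe.2 ?_)
  rw [bot_lt_iff_ne_bot]
  rcases le_total x y with h1 | h1
  · rwa [inf_eq_left.2 h1]
  · rwa [inf_eq_right.2 h1]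

theorem side_of_bot_edge {f : P.Ered} {x : P.Vred} (h : P.endsRed f = s(⊥, x)) :
    P.side x = true := by
  rcases f with a | e
  · simp only [endsRed] at h
    rcases Sym2.eq_iff.1 h with ⟨-, h1⟩ | ⟨-, h1⟩
    · rw [← h1]; rfl
    · simp at h1
  · exfalso
    simp only [endsRed] at h
    have : (⊥ : P.Vred) ∈ Sym2.map P.liftV (P.ends e) := by rw [h]; exact Sym2.mem_mk_left _ _
    obtain ⟨y, -, hy⟩ := Sym2.mem_map.1 this
    simp at hy

theorem endsRed_exists (f : P.Ered) : ∃ x y, P.endsRed f = s(x, y) := by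
  induction h : P.endsRed f with
  | _ a b => exact ⟨a, b, rfl⟩

variable {ord : LinearOrder P.EB}

theorem ord_asymm {e f : P.EB} (h1 : ord.lt e f) (h2 : ord.lt f e) : False :=
  @lt_asymm P.EB ord.toPreorder e f h1 h2

theorem passive_red (hord : P.AdmissibleOrder ord) {T : Finset P.EB}
    (hT : IsSpanningTree P.endsB T) {f : P.Ered} (hf : P.redToEB f ∈ T) :
    P.InternallyPassive ord T (P.redToEB f) := by
  refine ⟨hf, ?_⟩
  obtain ⟨x, y, hxy⟩ := endsRed_exists f
  have hcut : ¬ Reachable P.endsB (T.erase (P.redToEB f)) (P.liftW x) (P.liftW y) :=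
    hT.1 _ hf _ _ (by rw [endsB_red, hxy]; rfl)
  obtain ⟨z, z', hzz, hz⟩ : ∃ z z', P.endsRed f = s(z, z') ∧
      ¬ Reachable P.endsB (T.erase (P.redToEB f)) ⊥ (P.liftW z) := by
    by_cases h : Reachable P.endsB (T.erase (P.redToEB f)) ⊥ (P.liftW x)
    · exact ⟨y, x, by rw [hxy, Sym2.eq_swap], fun h2 => hcut (h.symm.trans h2)⟩
    · exact ⟨x, y, hxy, h⟩
  by_cases h0 : Reachable P.endsB (T.erase (P.redToEB f)) ⊥ (P.liftW ⊥)
  · refine ⟨P.cV z, hord _ _ ?_, (exchange_iff hT hf (endsB_cV z)).2 ?_⟩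
    · rcases hub_cases z with h1 | h1
      · exact lexEnds_lt_red hxy h1.1
      · refine lexEnds_lt_red' hzz h1.1 h1.2.1 ?_
        rintro rfl
        have := side_of_bot_edge (hzz.trans Sym2.eq_swap)
        rw [this] at h1
        simp at h1
    · intro h2
      rcases hub_cases z with h1 | h1
      · rw [h1.1] at h2; exact hz h2
      · rw [h1.1] at h2; exact hz (h0.trans h2)
  · exact ⟨P.cV ⊥, hord _ _ (lexEnds_lt_red hxy rfl), (exchange_iff hT hf (endsB_cV ⊥)).2 h0⟩

theorem not_passive_e00 (hord : P.AdmissibleOrder ord) {T : Finset P.EB} :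
    ¬ P.InternallyPassive ord T (P.cV ⊥) := by
  rintro ⟨h0, f, hf, -⟩
  rcases eb_cases f with ⟨v, rfl⟩ | ⟨g, rfl⟩
  · by_cases hv : v = ⊥
    · subst hv; exact ord_asymm hf hf
    · exact ord_asymm hf (hord _ _ (lexEnds_mono (bot_lt_iff_ne_bot.2 hv)))
  · obtain ⟨x, y, hxy⟩ := endsRed_exists g
    exact ord_asymm hf (hord _ _ (lexEnds_lt_red hxy rfl))

theorem passive_cV (hord : P.AdmissibleOrder ord) {T : Finset P.EB}
    (hT : IsSpanningTree P.endsB T) {r : P.Vred} (hr0 : r ≠ ⊥) (hr : P.cV r ∈ T) :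
    P.InternallyPassive ord T (P.cV r) ↔ tgt T r ≠ r := by
  have hG := good_of_tree hT
  by_cases hs : ∃ s, Rt T s ∧ s ≠ r ∧ RR T r s
  · obtain ⟨s, hs, hsr, hrr⟩ := hs
    rw [hG.tgt_eq (Or.inr hr) hs hsr hrr]
    refine iff_of_true ⟨hr, P.cV ⊥, hord _ _ (lexEnds_mono (bot_lt_iff_ne_bot.2 hr0)),
      (exchange_iff hT hr (endsB_cV ⊥)).2 (hG.no_conn (Or.inr hr) hr0 hs hsr.symm hrr)⟩ hsr
  · push Not at hs
    rw [tgt_eq_mn hs]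
    have hcut : ∀ w, Reachable P.endsB (T.erase (P.cV r)) (P.liftW r) w ∨
        Reachable P.endsB (T.erase (P.cV r)) (P.hub r) w := by
      intro w
      rcases Reachable.split (endsB_cV r) (hT.2 (P.liftW r) w) with h | h | h
      · exact Or.inl h
      · exact Or.inl h.2
      · exact Or.inr h.2
    have hno : ∀ v, Reachable P.endsB (T.erase (P.cV r)) (P.hub r) (P.hub v) :=
      fun v => (hcut _).resolve_left (not_reach_hub hr0 hs)
    have hnb : ¬ RR T r ⊥ := hs ⊥ (Rt_bot T) hr0.symm
    have hcomp : ∀ v, Reachable P.endsB (T.erase (P.cV r)) (P.liftW r) (P.liftW v) → RR T r v := by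
      intro v hv
      obtain ⟨u, h1, h2⟩ := Good.cut hr0 hs hv
      rw [liftW_inj] at h1
      subst h1; exact h2
    constructor
    · rintro ⟨-, f, hf, htree⟩
      suffices h : ∃ v, v < r ∧ RR T r v by
        obtain ⟨v, hv, hrv⟩ := h
        exact (lt_of_le_of_lt (mn_le hrv) hv).ne
      rcases eb_cases f with ⟨v, rfl⟩ | ⟨g, rfl⟩
      · refine ⟨v, ?_, ?_⟩
        · rcases lt_trichotomy v r with h | h | h
          · exact h
          · subst h; exact (ord_asymm hf hf).elim
          · exact (ord_asymm hf (hord _ _ (lexEnds_mono h))).elim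
        · rw [exchange_iff hT hr (endsB_cV v)] at htree
          rcases hcut (P.liftW v) with h | h
          · exact hcomp v h
          · exact absurd ((hno v).symm.trans h) htree
      · obtain ⟨x, y, hxy⟩ := endsRed_exists g
        rcases hub_cases r with h1 | h1
        · exact (ord_asymm hf (hord _ _ (lexEnds_lt_red hxy h1.1))).elim
        · obtain ⟨z, hz⟩ : ∃ z, P.endsRed g = s(⊥, z) := by
            by_cases hx : x = ⊥
            · subst hx; exact ⟨y, hxy⟩
            by_cases hy : y = ⊥
            · subst hy; exact ⟨x, hxy.trans Sym2.eq_swap⟩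
            exact (ord_asymm hf (hord _ _ (lexEnds_lt_red' hxy h1.1 hx hy))).elim
          refine ⟨z, lt_of_side (side_of_bot_edge hz) h1.2.2 hr0, ?_⟩
          rw [exchange_iff hT hr (x := P.liftW ⊥) (y := P.liftW z)
            (by rw [endsB_red, hz]; rfl)] at htree
          rcases hcut (P.liftW z) with h | h
          · exact hcomp z h
          · rw [h1.1] at h; exact absurd h htree
    · intro hne
      have hlt : mn (P.redOf T) r < r := lt_of_le_of_ne (mn_le (Reachable.refl _)) hne
      refine ⟨hr, P.cV (mn (P.redOf T) r), hord _ _ (lexEnds_mono hlt),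
        (exchange_iff hT hr (endsB_cV _)).2 ?_⟩
      intro h
      have h1 : Reachable P.endsB (T.erase (P.cV r)) (P.liftW r)
          (P.liftW (mn (P.redOf T) r)) := by
        apply RR.lift
        rw [RR, redOf_erase_cV]; exact mn_reach _ _
      exact not_reach_hub hr0 hs (h1.trans h.symm)

theorem ipCount_eq (hord : P.AdmissibleOrder ord) {T : Finset P.EB}
    (hT : IsSpanningTree P.endsB T) :
    P.ipCount ord T = (P.redOf T).card +
      (Finset.univ.filter fun r : P.Vred => r ≠ ⊥ ∧ P.cV r ∈ T ∧ tgt T r ≠ r).card := by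
  unfold ipCount
  have : (T.filter fun e => P.InternallyPassive ord T e) =
      (P.redOf T).map ⟨P.redToEB, redToEB_injective⟩ ∪
      (Finset.univ.filter fun r : P.Vred => r ≠ ⊥ ∧ P.cV r ∈ T ∧ tgt T r ≠ r).map
        ⟨P.cV, cV_injective⟩ := by
    ext e
    simp only [Finset.mem_filter, Finset.mem_union, Finset.mem_map, Finset.mem_univ, true_and,
      Function.Embedding.coeFn_mk, mem_redOf]
    constructor
    · rintro ⟨he, hp⟩
      rcases eb_cases e with ⟨v, rfl⟩ | ⟨g, rfl⟩
      · right
        have hv : v ≠ ⊥ := by rintro rfl; exact not_passive_e00 hord hp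
        exact ⟨v, ⟨hv, he, (passive_cV hord hT hv he).1 hp⟩, rfl⟩
      · exact Or.inl ⟨g, he, rfl⟩
    · rintro (⟨g, hg, rfl⟩ | ⟨v, ⟨h1, h2, h3⟩, rfl⟩)
      · exact ⟨hg, passive_red hord hT hg⟩
      · exact ⟨h2, (passive_cV hord hT h1 h2).2 h3⟩
  rw [this, Finset.card_union_of_disjoint, Finset.card_map, Finset.card_map]
  rw [Finset.disjoint_left]
  intro e h1 h2
  obtain ⟨g, -, rfl⟩ := Finset.mem_map.1 h1
  obtain ⟨v, -, hv⟩ := Finset.mem_map.1 h2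
  exact cV_ne_red _ _ hv

end BiconedGraph

/-! ### The 2-edge-rooted forest of a spanning tree -/

namespace BiconedGraph

variable {P : BiconedGraph}

/-- First-edge relation in the reduced graph. -/
abbrev FE (F : Finset P.Ered) (r t : P.Vred) (e : P.Ered) : Prop := FirstE P.endsRed F r t e

/-- The roots whose mark lies on the edge `e`. -/
def marks (T : Finset P.EB) (e : P.Ered) : Finset P.Vred :=
  Finset.univ.filter fun r => r ≠ ⊥ ∧ P.cV r ∈ T ∧ FE (P.redOf T) r (tgt T r) e

theorem mem_marks {T : Finset P.EB} {e : P.Ered} {r : P.Vred} :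
    r ∈ marks T e ↔ r ≠ ⊥ ∧ P.cV r ∈ T ∧ FE (P.redOf T) r (tgt T r) e := by
  simp [marks]

/-- The 2-edge-rooted forest of a spanning tree. -/
def multOf (T : Finset P.EB) (e : P.Ered) : ℕ :=
  if e ∈ P.redOf T then 1 + (marks T e).card else 0

theorem mSupport_multOf (T : Finset P.EB) : P.mSupport (multOf T) = P.redOf T := by
  ext e
  rw [mSupport, Finset.mem_filter]
  unfold multOf
  split_ifs with h <;> simp [h]

theorem sum_marks {T : Finset P.EB} (hF : IsAcyclic P.endsRed (P.redOf T)) (K : P.Vred → Prop)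
    (K' : P.Ered → Prop) (hK : ∀ r e, r ∈ marks T e → (K' e ↔ K r)) :
    (∑ e ∈ P.redOf T, if K' e then (marks T e).card else 0) =
    (Finset.univ.filter fun r : P.Vred => (r ≠ ⊥ ∧ P.cV r ∈ T ∧ tgt T r ≠ r) ∧ K r).card := by
  have h1 : ∀ e ∈ P.redOf T, (if K' e then (marks T e).card else 0) =
      ∑ r : P.Vred, if K' e ∧ r ∈ marks T e then 1 else 0 := by
    intro e _
    split_ifs with h
    · simp [h]
    · simp [h]
  rw [Finset.sum_congr rfl h1, Finset.sum_comm, Finset.card_filter]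
  refine Finset.sum_congr rfl ?_
  intro r _
  split_ifs with h
  · obtain ⟨⟨ha, hb, hc⟩, hd⟩ := h
    obtain ⟨e, he⟩ := FirstE.exists hF (Ne.symm hc) (tgt_reach T r)
    have hm : r ∈ marks T e := mem_marks.2 ⟨ha, hb, he⟩
    rw [Finset.sum_eq_single e]
    · rw [if_pos ⟨(hK r e hm).2 hd, hm⟩]
    · intro e' _ hne
      rw [if_neg]
      rintro ⟨-, h2⟩
      exact hne (FirstE.unique hF (mem_marks.1 h2).2.2 he)
    · intro h; exact absurd he.1 h
  · apply Finset.sum_eq_zero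
    intro e _
    rw [if_neg]
    rintro ⟨h1, h2⟩
    have h3 := mem_marks.1 h2
    exact h ⟨⟨h3.1, h3.2.1, h3.2.2.ne.symm⟩, (hK r e h2).1 h1⟩

theorem deg_multOf {T : Finset P.EB} (hF : IsAcyclic P.endsRed (P.redOf T)) :
    P.deg (multOf T) = (P.redOf T).card +
      (Finset.univ.filter fun r : P.Vred => r ≠ ⊥ ∧ P.cV r ∈ T ∧ tgt T r ≠ r).card := by
  have h := sum_marks hF (fun _ => True) (fun _ => True) (fun _ _ _ => Iff.rfl)
  simp only [if_true, and_true] at h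
  rw [← h, deg]
  simp only [multOf]
  rw [Finset.sum_ite_mem, Finset.univ_inter, Finset.sum_add_distrib]
  simp

/-- The roots in the component of `v` which count for `compCount`. -/
def cnt (T : Finset P.EB) (v : P.Vred) : Finset P.Vred :=
  Finset.univ.filter fun r => Rt T r ∧ RR T v r ∧ (r = ⊥ ∨ tgt T r ≠ r)

theorem mem_cnt {T : Finset P.EB} {v r : P.Vred} :
    r ∈ cnt T v ↔ Rt T r ∧ RR T v r ∧ (r = ⊥ ∨ tgt T r ≠ r) := by
  simp [cnt]

theorem compCount_multOf {T : Finset P.EB} (hF : IsAcyclic P.endsRed (P.redOf T)) (v : P.Vred) :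
    P.compCount (multOf T) v = (cnt T v).card := by
  unfold compCount compEdgeRoots
  rw [mSupport_multOf]
  have h1 : ∀ e ∈ P.redOf T, (if P.Touches (P.redOf T) v e then multOf T e - 1 else 0) =
      if P.Touches (P.redOf T) v e then (marks T e).card else 0 := by
    intro e he
    simp [multOf, he]
  rw [Finset.sum_congr rfl h1, sum_marks hF (fun r => RR T v r) (fun e => P.Touches (P.redOf T) v e)]
  · have hsplit : cnt T v = (Finset.univ.filter fun r : P.Vred =>
        (r ≠ ⊥ ∧ P.cV r ∈ T ∧ tgt T r ≠ r) ∧ RR T v r) ∪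
        (if RR T v ⊥ then {⊥} else ∅) := by
      ext r
      simp only [mem_cnt, Finset.mem_union, Finset.mem_filter, Finset.mem_univ, true_and, Rt]
      by_cases hr : r = ⊥
      · subst hr
        by_cases hb : RR T v ⊥
        · simp [hb]
        · simp [hb]
      · have : r ∉ (if RR T v ⊥ then ({⊥} : Finset P.Vred) else ∅) := by
          split_ifs <;> simp [hr]
        simp only [hr, this]
        tauto
    rw [hsplit, Finset.card_union_of_disjoint]
    · congr 1
      split_ifs <;> simp
    · rw [Finset.disjoint_left]
      intro r h2 h3
      have h4 := (Finset.mem_filter.1 h2).2.1.1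
      split_ifs at h3
      · simp at h3; exact h4 h3
      · simp at h3
  · intro r e hr
    have hr' := (mem_marks.1 hr).2.2
    constructor
    · rintro ⟨u, hu, hvu⟩
      exact hvu.trans (Reachable.of_mem hr'.1 hu hr'.2.1)
    · intro h
      exact ⟨r, hr'.2.1, h⟩

theorem Good.cnt_le {T : Finset P.EB} (h : Good T) (v : P.Vred) : (cnt T v).card ≤ 2 := by
  have : (cnt T v).card ≤ (Finset.univ : Finset Bool).card := by
    refine Finset.card_le_card_of_injOn P.side (fun _ _ => Finset.mem_univ _) ?_
    intro r hr s hs hrs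
    by_contra hne
    have h1 := mem_cnt.1 hr
    have h2 := mem_cnt.1 hs
    exact (h.sides r s h1.1 h2.1 hne (h1.2.1.symm.trans h2.2.1)).1 hrs
  simpa using this

theorem Good.compCount_two {T : Finset P.EB} (h : Good T) (v : P.Vred) :
    P.compCount (multOf T) v = 2 ↔
      ∃ r s, Rt T r ∧ Rt T s ∧ r ≠ s ∧ RR T v r ∧ RR T v s := by
  rw [compCount_multOf h.acyc]
  constructor
  · intro h2
    obtain ⟨r, hr, s, hs, hne⟩ := Finset.one_lt_card.1 (by omega : 1 < (cnt T v).card)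
    have h1 := mem_cnt.1 hr
    have h2 := mem_cnt.1 hs
    exact ⟨r, s, h1.1, h2.1, hne, h1.2.1, h2.2.1⟩
  · rintro ⟨r, s, hr, hs, hne, h1, h2⟩
    refine le_antisymm (h.cnt_le v) ?_
    have hrs := h1.symm.trans h2
    exact Finset.one_lt_card.2 ⟨r, mem_cnt.2 ⟨hr, h1, Or.inr (by
      rw [h.tgt_eq hr hs hne.symm hrs]; exact hne.symm)⟩, s, mem_cnt.2 ⟨hs, h2, Or.inr (by
      rw [h.tgt_eq hs hr hne hrs.symm]; exact hne)⟩, hne⟩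

theorem two_le_multOf {T : Finset P.EB} {e : P.Ered} :
    2 ≤ multOf T e ↔ ∃ r, r ∈ marks T e := by
  rw [multOf]
  split_ifs with h
  · rw [show (2 ≤ 1 + (marks T e).card) ↔ 0 < (marks T e).card by omega, Finset.card_pos]
    rfl
  · refine iff_of_false (by omega) ?_
    rintro ⟨r, hr⟩
    exact h (mem_marks.1 hr).2.2.1

theorem three_le_multOf {T : Finset P.EB} {e : P.Ered} :
    3 ≤ multOf T e ↔ ∃ r ∈ marks T e, ∃ s ∈ marks T e, r ≠ s := by
  rw [multOf]
  split_ifs with h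
  · rw [show (3 ≤ 1 + (marks T e).card) ↔ 1 < (marks T e).card by omega, Finset.one_lt_card]
  · refine iff_of_false (by omega) ?_
    rintro ⟨r, hr, -⟩
    exact h (mem_marks.1 hr).2.2.1

theorem Good.marks_le {T : Finset P.EB} (h : Good T) (e : P.Ered) : (marks T e).card ≤ 2 := by
  rcases (marks T e).eq_empty_or_nonempty with h0 | ⟨r, hr⟩
  · simp [h0]
  refine le_trans (Finset.card_le_card ?_) (h.cnt_le r)
  intro s hs
  have h1 := mem_marks.1 hr
  have h2 := mem_marks.1 hs
  exact mem_cnt.2 ⟨Or.inr h2.2.1, Reachable.of_mem h1.2.2.1 h1.2.2.2.1 h2.2.2.2.1,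
    Or.inr h2.2.2.ne.symm⟩

theorem getLast_of_ne_nil {α : Type} {l : List α} (h : l ≠ []) : ∃ e, l.getLast? = some e := by
  cases hl : l.getLast? with
  | none => exact absurd (List.getLast?_eq_none_iff.1 hl) h
  | some e => exact ⟨e, rfl⟩

theorem head_of_ne_nil {α : Type} {l : List α} (h : l ≠ []) : ∃ e, l.head? = some e := by
  cases l with
  | nil => exact absurd rfl h
  | cons e _ => exact ⟨e, rfl⟩

theorem Good.is2ERF {T : Finset P.EB} (h : Good T) : P.Is2ERF (multOf T) := by
  refine ⟨?_, ?_, ?_, ?_⟩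
  · rw [mSupport_multOf]; exact h.acyc
  · intro v
    rw [compCount_multOf h.acyc]; exact h.cnt_le v
  · intro u v hu hv
    rw [mSupport_multOf]
    obtain ⟨r, s, hr, hs, hne, h1, h2⟩ := (h.compCount_two u).1 hu
    obtain ⟨r', s', hr', hs', hne', h1', h2'⟩ := (h.compCount_two v).1 hv
    exact h1.trans ((h.uniq r s r' s' hr hs hne (h1.symm.trans h2) hr' hs' hne'
      (h1'.symm.trans h2')).trans h1'.symm)
  · intro v hv
    obtain ⟨r, s, hr, hs, hne, h1, h2⟩ := (h.compCount_two v).1 hv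
    unfold C3At
    rw [mSupport_multOf]
    constructor
    · intro hb
      obtain ⟨x, hx, hx0, hxv⟩ : ∃ x, Rt T x ∧ x ≠ ⊥ ∧ RR T v x := by
        by_cases hr0 : r = ⊥
        · exact ⟨s, hs, by rw [← hr0]; exact hne.symm, h2⟩
        · exact ⟨r, hr, hr0, h1⟩
      have hxb : RR T x ⊥ := hxv.symm.trans hb
      have ht := h.tgt_eq hx (Rt_bot T) hx0.symm hxb
      obtain ⟨p, hp, hpF⟩ := MWalk.exists_path hxb.symm
      refine ⟨x, p, hp, hpF, ?_, ?_⟩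
      · obtain ⟨e, he⟩ := getLast_of_ne_nil (p.edges_ne_nil hx0.symm)
        refine ⟨e, he, two_le_multOf.2 ⟨x, mem_marks.2 ⟨hx0, hx.resolve_left hx0, ?_⟩⟩⟩
        rw [ht]
        exact p.first_of_last h.acyc hp hpF he
      · rw [MWalk.odd_bridgeCount]
        exact (h.sides ⊥ x (Rt_bot T) hx hx0.symm hxb.symm).1
    · intro hb
      have hr0 : r ≠ ⊥ := by rintro rfl; exact hb h1
      have hs0 : s ≠ ⊥ := by rintro rfl; exact hb h2
      have hrs : RR T r s := h1.symm.trans h2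
      have htr := h.tgt_eq hr hs hne.symm hrs
      have hts := h.tgt_eq hs hr hne hrs.symm
      obtain ⟨p, hp, hpF⟩ := MWalk.exists_path hrs
      obtain ⟨e, he⟩ := head_of_ne_nil (p.edges_ne_nil hne)
      obtain ⟨f, hf⟩ := getLast_of_ne_nil (p.edges_ne_nil hne)
      have hme : r ∈ marks T e := mem_marks.2 ⟨hr0, hr.resolve_left hr0, by
        rw [htr]; exact p.first_of_head h.acyc hp hpF he⟩
      have hmf : s ∈ marks T f := mem_marks.2 ⟨hs0, hs.resolve_left hs0, by
        rw [hts]; exact p.first_of_last h.acyc hp hpF hf⟩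
      refine ⟨r, s, p, hp, hpF, h1, ⟨e, he, two_le_multOf.2 ⟨r, hme⟩⟩,
        ⟨f, hf, two_le_multOf.2 ⟨s, hmf⟩⟩, ?_, ?_⟩
      · intro g hg
        rw [hg] at he hf
        simp only [List.head?_cons, List.getLast?_singleton, Option.some.injEq] at he hf
        subst he hf
        have h3 : 3 ≤ multOf T g := three_le_multOf.2 ⟨r, hme, s, hmf, hne⟩
        have h4 := h.marks_le g
        have h5 : multOf T g ≤ 1 + (marks T g).card := by
          unfold multOf; split_ifs <;> omega
        omega
      · rw [MWalk.odd_bridgeCount]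
        exact (h.sides r s hr hs hne hrs).1

end BiconedGraph

/-! ### Injectivity -/

namespace BiconedGraph

variable {P : BiconedGraph}

theorem Good.two_congr {T : Finset P.EB} (h : Good T) {u v : P.Vred} (huv : RR T u v)
    (hu : P.compCount (multOf T) u = 2) : P.compCount (multOf T) v = 2 := by
  obtain ⟨r, s, hr, hs, hne, h1, h2⟩ := (h.compCount_two u).1 hu
  exact (h.compCount_two v).2 ⟨r, s, hr, hs, hne, huv.symm.trans h1, huv.symm.trans h2⟩

theorem Good.tgt_caseB {T : Finset P.EB} (h : Good T) {x : P.Vred} (hx : Rt T x) (hx0 : x ≠ ⊥)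
    (hB : ¬ (P.compCount (multOf T) x = 2 ∧ ¬ RR T x ⊥)) : tgt T x = mn (P.redOf T) x := by
  by_cases hb : RR T x ⊥
  · rw [mn_bot hb, h.tgt_eq hx (Rt_bot T) hx0.symm hb]
  · refine tgt_eq_mn ?_
    intro s hs hne hr
    exact hB ⟨(h.compCount_two x).2 ⟨x, s, hx, hs, hne.symm, Reachable.refl _, hr⟩, hb⟩

theorem Good.tgt_caseA {T : Finset P.EB} (h : Good T) {x : P.Vred} (hx : Rt T x)
    (h2 : P.compCount (multOf T) x = 2) (hb : ¬ RR T x ⊥) :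
    ∃ s, Rt T s ∧ s ≠ ⊥ ∧ s ≠ x ∧ RR T x s ∧ tgt T x = s ∧ tgt T s = x := by
  obtain ⟨r, s, hr, hs, hne, h1, h2⟩ := (h.compCount_two x).1 h2
  obtain ⟨s, hs, hne, h2⟩ : ∃ s, Rt T s ∧ s ≠ x ∧ RR T x s := by
    by_cases hxs : s = x
    · subst hxs; exact ⟨r, hr, hne, h1⟩
    · exact ⟨s, hs, hxs, h2⟩
  refine ⟨s, hs, ?_, hne, h2, h.tgt_eq hx hs hne h2, h.tgt_eq hs hx hne.symm h2.symm⟩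
  rintro rfl
  exact hb h2

theorem Good.inj_aux {T T' : Finset P.EB} (h : Good T) (h' : Good T') (hm : multOf T = multOf T')
    (hF : P.redOf T = P.redOf T') {x : P.Vred} (hx0 : x ≠ ⊥) (hx : Rt T x) : Rt T' x := by
  have hRR : ∀ u v, RR T' u v ↔ RR T u v := by
    intro u v; unfold RR; rw [hF]
  by_cases hA : P.compCount (multOf T) x = 2 ∧ ¬ RR T x ⊥
  · obtain ⟨s, hs, hs0, hsx, hrr, t1, t2⟩ := h.tgt_caseA hx hA.1 hA.2
    obtain ⟨e, he⟩ := FirstE.exists h.acyc hsx.symm hrr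
    obtain ⟨f, hf⟩ := FirstE.exists h.acyc hsx hrr.symm
    have hxe : x ∈ marks T e := mem_marks.2 ⟨hx0, hx.resolve_left hx0, by rw [t1]; exact he⟩
    have hsf : s ∈ marks T f := mem_marks.2 ⟨hs0, hs.resolve_left hs0, by rw [t2]; exact hf⟩
    by_cases hef : e = f
    · subst hef
      have h3 : 3 ≤ multOf T' e := by
        rw [← hm]; exact three_le_multOf.2 ⟨x, hxe, s, hsf, hsx.symm⟩
      obtain ⟨x', hx', y', hy', hne⟩ := three_le_multOf.1 h3
      have m1 := mem_marks.1 hx'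
      have m2 := mem_marks.1 hy'
      have hends := (Sym2.mem_and_mem_iff hne).1 ⟨m1.2.2.2.1, m2.2.2.2.1⟩
      have hxm := he.2.1
      rw [hends] at hxm
      rcases Sym2.mem_iff.1 hxm with rfl | rfl
      · exact Or.inr m1.2.1
      · exact Or.inr m2.2.1
    · have h2 : 2 ≤ multOf T' e := by rw [← hm]; exact two_le_multOf.2 ⟨x, hxe⟩
      have h3 : 2 ≤ multOf T' f := by rw [← hm]; exact two_le_multOf.2 ⟨s, hsf⟩
      obtain ⟨x', hx'⟩ := two_le_multOf.1 h2
      obtain ⟨y', hy'⟩ := two_le_multOf.1 h3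
      have m1 := mem_marks.1 hx'
      have m2 := mem_marks.1 hy'
      have hne : x' ≠ y' := by
        rintro rfl
        exact hef (FirstE.unique h'.acyc m1.2.2 m2.2.2)
      have hr : RR T' x' y' := by
        rw [hRR]
        exact (Reachable.of_mem he.1 m1.2.2.2.1 he.2.1).trans
          (hrr.trans (Reachable.of_mem hf.1 hf.2.1 m2.2.2.2.1))
      have t1' := h'.tgt_eq (Or.inr m1.2.1) (Or.inr m2.2.1) hne.symm hr
      have t2' := h'.tgt_eq (Or.inr m2.2.1) (Or.inr m1.2.1) hne hr.symm
      have f1 := m1.2.2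
      have f2 := m2.2.2
      rw [t1'] at f1
      rw [t2'] at f2
      rw [hF] at he hf
      rw [FirstE.pair h'.acyc hef he hf f1 f2]
      exact Or.inr m1.2.1
  · have hB' : ∀ u, RR T x u → ¬ (P.compCount (multOf T') u = 2 ∧ ¬ RR T' u ⊥) := by
      rintro u hu ⟨h1, h2⟩
      rw [← hm] at h1
      rw [hRR] at h2
      exact hA ⟨h.two_congr hu.symm h1, fun hb => h2 (hu.symm.trans hb)⟩
    have hB : ∀ u, RR T x u → ¬ (P.compCount (multOf T) u = 2 ∧ ¬ RR T u ⊥) := by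
      rintro u hu ⟨h1, h2⟩
      exact hA ⟨h.two_congr hu.symm h1, fun hb => h2 (hu.symm.trans hb)⟩
    by_cases hxm : x = mn (P.redOf T) x
    · have hb : ¬ RR T x ⊥ := by
        intro hb
        exact hx0 (hxm.trans (mn_bot hb))
      obtain ⟨r, hr, hxr⟩ := h'.root x
      rw [hRR] at hxr
      have hr0 : r ≠ ⊥ := by rintro rfl; exact hb hxr
      by_cases hrx : r = x
      · rw [← hrx]; exact hr
      exfalso
      have htr := h'.tgt_caseB hr hr0 (hB' r hxr)
      rw [← hF, ← mn_congr hxr, ← hxm] at htr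
      obtain ⟨e, he⟩ := FirstE.exists h.acyc hrx hxr.symm
      have h2 : 2 ≤ multOf T e := by
        rw [hm]
        refine two_le_multOf.2 ⟨r, mem_marks.2 ⟨hr0, hr.resolve_left hr0, ?_⟩⟩
        rw [htr, ← hF]; exact he
      obtain ⟨y, hy⟩ := two_le_multOf.1 h2
      have m := mem_marks.1 hy
      have hxy : RR T x y := hxr.trans (Reachable.of_mem he.1 he.2.1 m.2.2.2.1)
      have hyt := h.tgt_caseB (Or.inr m.2.1) m.1 (hB y hxy)
      rw [← mn_congr hxy, ← hxm] at hyt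
      have hne := m.2.2.ne
      rw [hyt] at hne
      have := h.tgt_eq (Or.inr m.2.1) hx hne.symm hxy.symm
      exact hB x (Reachable.refl _) ⟨(h.compCount_two x).2 ⟨x, y, hx, Or.inr m.2.1, hne.symm,
        Reachable.refl _, hxy⟩, hb⟩
    · obtain ⟨e, he⟩ := FirstE.exists h.acyc hxm (mn_reach _ x)
      have h2 : 2 ≤ multOf T' e := by
        rw [← hm]
        refine two_le_multOf.2 ⟨x, mem_marks.2 ⟨hx0, hx.resolve_left hx0, ?_⟩⟩
        rw [h.tgt_caseB hx hx0 hA]; exact he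
      obtain ⟨y, hy⟩ := two_le_multOf.1 h2
      have m := mem_marks.1 hy
      have hxy : RR T x y := Reachable.of_mem he.1 he.2.1 m.2.2.2.1
      have f1 := m.2.2
      rw [h'.tgt_caseB (Or.inr m.2.1) m.1 (hB' y hxy), ← hF, ← mn_congr hxy] at f1
      rw [FirstE.inj h.acyc he f1]
      exact Or.inr m.2.1

theorem Good.e00_iff {T : Finset P.EB} (h : Good T) :
    P.e00 ∈ T ↔ ¬ ∃ v, P.compCount (multOf T) v = 2 := by
  constructor
  · rintro h0 ⟨v, hv⟩
    obtain ⟨r, s, hr, hs, hne, h1, h2⟩ := (h.compCount_two v).1 hv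
    exact (h.sides r s hr hs hne (h1.symm.trans h2)).2 h0
  · intro h0
    by_contra h1
    obtain ⟨r, s, hr, hs, hne, h2⟩ := h.exi h1
    exact h0 ⟨r, (h.compCount_two r).2 ⟨r, s, hr, hs, hne, Reachable.refl _, h2⟩⟩

theorem Good.inj {T T' : Finset P.EB} (h : Good T) (h' : Good T') (hm : multOf T = multOf T') :
    T = T' := by
  have hF : P.redOf T = P.redOf T' := by
    rw [← mSupport_multOf, ← mSupport_multOf, hm]
  ext e
  rcases eb_cases e with ⟨v, rfl⟩ | ⟨f, rfl⟩
  · by_cases hv : v = ⊥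
    · subst hv
      rw [cV_bot, h.e00_iff, h'.e00_iff, hm]
    · constructor
      · intro h1
        exact (h.inj_aux h' hm hF hv (Or.inr h1)).resolve_left hv
      · intro h1
        exact (h'.inj_aux h hm.symm hF.symm hv (Or.inr h1)).resolve_left hv
  · rw [← mem_redOf, ← mem_redOf, hF]

end BiconedGraph

/-! ### Surjectivity -/

namespace BiconedGraph

variable {P : BiconedGraph}

/-- Reachability in the support of `mult`. -/
abbrev MR (mult : P.Ered → ℕ) (u v : P.Vred) : Prop := Reachable P.endsRed (P.mSupport mult) u v

theorem mem_mSupport {mult : P.Ered → ℕ} {e : P.Ered} : e ∈ P.mSupport mult ↔ mult e ≠ 0 := by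
  rw [mSupport, Finset.mem_filter]; simp

theorem touches_congr {mult : P.Ered → ℕ} {u v : P.Vred} (h : MR mult u v) (e : P.Ered) :
    P.Touches (P.mSupport mult) u e ↔ P.Touches (P.mSupport mult) v e := by
  constructor
  · rintro ⟨w, hw, h1⟩; exact ⟨w, hw, h.symm.trans h1⟩
  · rintro ⟨w, hw, h1⟩; exact ⟨w, hw, h.trans h1⟩

theorem cer_congr {mult : P.Ered → ℕ} {u v : P.Vred} (h : MR mult u v) :
    P.compEdgeRoots mult u = P.compEdgeRoots mult v := by
  unfold compEdgeRoots
  refine Finset.sum_congr rfl ?_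
  intro e _
  simp only [touches_congr h e]

theorem compCount_congr {mult : P.Ered → ℕ} {u v : P.Vred} (h : MR mult u v) :
    P.compCount mult u = P.compCount mult v := by
  unfold compCount
  rw [cer_congr h]
  congr 1
  have : MR mult u ⊥ ↔ MR mult v ⊥ := ⟨fun h1 => h.symm.trans h1, fun h1 => h.trans h1⟩
  simp only [this]

theorem compCount_bot {mult : P.Ered → ℕ} {v : P.Vred} (h : MR mult v ⊥) :
    P.compCount mult v = P.compEdgeRoots mult v + 1 := by
  unfold compCount; rw [if_pos h]

theorem compCount_not_bot {mult : P.Ered → ℕ} {v : P.Vred} (h : ¬ MR mult v ⊥) :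
    P.compCount mult v = P.compEdgeRoots mult v := by
  unfold compCount; rw [if_neg h, add_zero]

theorem cer_pos {mult : P.Ered → ℕ} {v : P.Vred} (h : P.compEdgeRoots mult v ≠ 0) :
    ∃ e ∈ P.mSupport mult, (∃ u, u ∈ P.endsRed e ∧ MR mult v u) ∧ 2 ≤ mult e := by
  unfold compEdgeRoots at h
  obtain ⟨e, he, h1⟩ := Finset.exists_ne_zero_of_sum_ne_zero h
  split_ifs at h1 with h2
  · exact ⟨e, he, h2, by omega⟩
  · exact absurd rfl h1

theorem cer_sum {mult : P.Ered → ℕ} {v : P.Vred} (S : Finset P.Ered)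
    (hS : ∀ e ∈ S, e ∈ P.mSupport mult ∧ ∃ u, u ∈ P.endsRed e ∧ MR mult v u) :
    ∑ e ∈ S, (mult e - 1) ≤ P.compEdgeRoots mult v := by
  unfold compEdgeRoots
  have h1 : ∑ e ∈ S, (mult e - 1) =
      ∑ e ∈ S, if P.Touches (P.mSupport mult) v e then mult e - 1 else 0 := by
    refine Finset.sum_congr rfl ?_
    intro e he
    exact (if_pos (c := P.Touches (P.mSupport mult) v e) (hS e he).2).symm
  rw [h1]
  exact Finset.sum_le_sum_of_subset (fun e he => (hS e he).1)

theorem cer_one {mult : P.Ered → ℕ} {v u : P.Vred} {e : P.Ered} (he : e ∈ P.mSupport mult)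
    (hu : u ∈ P.endsRed e) (hv : MR mult v u) : mult e - 1 ≤ P.compEdgeRoots mult v := by
  have := cer_sum (mult := mult) (v := v) {e} (by
    intro f hf; rw [Finset.mem_singleton.1 hf]; exact ⟨he, u, hu, hv⟩)
  simpa using this

theorem cer_two {mult : P.Ered → ℕ} {v u u' : P.Vred} {e e' : P.Ered} (he : e ∈ P.mSupport mult)
    (hu : u ∈ P.endsRed e) (hv : MR mult v u) (he' : e' ∈ P.mSupport mult)
    (hu' : u' ∈ P.endsRed e') (hv' : MR mult v u') (hne : e ≠ e') :
    (mult e - 1) + (mult e' - 1) ≤ P.compEdgeRoots mult v := by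
  have := cer_sum (mult := mult) (v := v) {e, e'} (by
    intro f hf
    rcases Finset.mem_insert.1 hf with rfl | hf
    · exact ⟨he, u, hu, hv⟩
    · rw [Finset.mem_singleton.1 hf]; exact ⟨he', u', hu', hv'⟩)
  rwa [Finset.sum_pair hne] at this

theorem cer_three {mult : P.Ered → ℕ} {v u u' u'' : P.Vred} {e e' e'' : P.Ered}
    (he : e ∈ P.mSupport mult) (hu : u ∈ P.endsRed e) (hv : MR mult v u)
    (he' : e' ∈ P.mSupport mult) (hu' : u' ∈ P.endsRed e') (hv' : MR mult v u')
    (he'' : e'' ∈ P.mSupport mult) (hu'' : u'' ∈ P.endsRed e'') (hv'' : MR mult v u'')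
    (hne : e ≠ e') (hne' : e ≠ e'') (hne'' : e' ≠ e'') :
    (mult e - 1) + ((mult e' - 1) + (mult e'' - 1)) ≤ P.compEdgeRoots mult v := by
  have := cer_sum (mult := mult) (v := v) {e, e', e''} (by
    intro f hf
    rcases Finset.mem_insert.1 hf with rfl | hf
    · exact ⟨he, u, hu, hv⟩
    rcases Finset.mem_insert.1 hf with rfl | hf
    · exact ⟨he', u', hu', hv'⟩
    · rw [Finset.mem_singleton.1 hf]; exact ⟨he'', u'', hu'', hv''⟩)
  rwa [Finset.sum_insert (by simp [hne, hne']), Finset.sum_pair hne''] at this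

theorem path_single {ε ν : Type} {ends : ε → Sym2 ν} {u v : ν} (p : MWalk ends u v)
    (hp : p.IsPath) {e : ε} (h1 : p.edges.head? = some e) (h2 : p.edges.getLast? = some e) :
    p.edges = [e] := by
  cases p with
  | nil u => simp [MWalk.edges] at h1
  | cons f w h q =>
    simp only [MWalk.edges, List.head?_cons, Option.some.injEq] at h1
    subst h1
    simp only [MWalk.edges] at h2 ⊢
    cases hq : q.edges with
    | nil => rfl
    | cons g l =>
      exfalso
      rw [hq, List.getLast?_cons_cons, ← hq] at h2
      have hmem : f ∈ q.edges := List.mem_of_getLast? h2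
      have hu : u ∈ q.support := q.mem_support_of_mem_edges hmem (by rw [h]; simp)
      unfold MWalk.IsPath at hp
      simp only [MWalk.support, List.nodup_cons] at hp
      exact hp.1 hu

/-- The component of `v` has two edge roots and does not contain `0̄`. -/
def CA (mult : P.Ered → ℕ) (v : P.Vred) : Prop := P.compCount mult v = 2 ∧ ¬ MR mult v ⊥

theorem CA.congr {mult : P.Ered → ℕ} {u v : P.Vred} (h : CA mult u) (huv : MR mult u v) :
    CA mult v :=
  ⟨(compCount_congr huv).symm.trans h.1, fun hb => h.2 (huv.trans hb)⟩

/-- The data of the two roots in a component with two edge roots not containing `0̄`. -/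
structure AData (mult : P.Ered → ℕ) (x y v : P.Vred) : Prop where
  rx : MR mult v x
  ry : MR mult v y
  ne : x ≠ y
  sd : P.side x ≠ P.side y
  ex : ∃ e f, FE (P.mSupport mult) x y e ∧ FE (P.mSupport mult) y x f ∧ 2 ≤ mult e ∧ 2 ≤ mult f ∧
    (e = f → mult e = 3)

theorem exists_AData {mult : P.Ered → ℕ} (h : P.Is2ERF mult) :
    ∃ x y, ∀ v, CA mult v → AData mult x y v := by
  by_cases hA : ∃ v, CA mult v
  · obtain ⟨v, hv⟩ := hA
    obtain ⟨x, y, p, hp, hpF, hvx, ⟨e, he, he2⟩, ⟨f, hf, hf2⟩, h3, hodd⟩ := (h.2.2.2 v hv.1).2 hv.2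
    rw [MWalk.odd_bridgeCount] at hodd
    refine ⟨x, y, ?_⟩
    intro w hw
    have hwv := h.2.2.1 w v hw.1 hv.1
    refine ⟨hwv.trans hvx, hwv.trans (hvx.trans ⟨p, hpF⟩), ?_, hodd, e, f,
      p.first_of_head h.1 hp hpF he, p.first_of_last h.1 hp hpF hf, he2, hf2, ?_⟩
    · rintro rfl; exact hodd rfl
    · rintro rfl
      exact h3 e (path_single p hp he hf)
  · exact ⟨⊥, ⊥, fun v hv => absurd ⟨v, hv⟩ hA⟩

/-- The reconstructed roots. -/
def Rc (mult : P.Ered → ℕ) (x0 y0 x : P.Vred) : Prop :=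
  (CA mult x ∧ (x = x0 ∨ x = y0)) ∨
  (¬ CA mult x ∧ ((∃ e, 2 ≤ mult e ∧ FE (P.mSupport mult) x (mn (P.mSupport mult) x) e) ∨
    (x = mn (P.mSupport mult) x ∧ P.compEdgeRoots mult x = 0)))

/-- Membership in the reconstructed tree. -/
def InRec (mult : P.Ered → ℕ) (x0 y0 : P.Vred) (e : P.EB) : Prop :=
  (∃ x, x ≠ ⊥ ∧ e = P.cV x ∧ Rc mult x0 y0 x) ∨
    (e = P.e00 ∧ ¬ ∃ v, P.compCount mult v = 2) ∨ ∃ f ∈ P.mSupport mult, e = P.redToEB f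

/-- The reconstructed tree. -/
def recT (mult : P.Ered → ℕ) (x0 y0 : P.Vred) : Finset P.EB :=
  Finset.univ.filter fun e => InRec mult x0 y0 e

theorem cV_mem_recT {mult : P.Ered → ℕ} {x0 y0 x : P.Vred} (hx : x ≠ ⊥) :
    P.cV x ∈ recT mult x0 y0 ↔ Rc mult x0 y0 x := by
  rw [recT, Finset.mem_filter]
  constructor
  · rintro ⟨-, ⟨y, hy, h1, h2⟩ | ⟨h1, -⟩ | ⟨f, -, h1⟩⟩
    · rw [cV_injective h1]; exact h2
    · exact absurd (cV_injective (h1.trans (by rfl : P.e00 = P.cV ⊥))) hx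
    · exact absurd h1 (cV_ne_red x f)
  · intro h
    exact ⟨Finset.mem_univ _, Or.inl ⟨x, hx, rfl, h⟩⟩

theorem e00_mem_recT {mult : P.Ered → ℕ} {x0 y0 : P.Vred} :
    P.e00 ∈ recT mult x0 y0 ↔ ¬ ∃ v, P.compCount mult v = 2 := by
  rw [recT, Finset.mem_filter]
  constructor
  · rintro ⟨-, ⟨y, hy, h1, h2⟩ | ⟨-, h1⟩ | ⟨f, -, h1⟩⟩
    · exact absurd (cV_injective ((by rfl : P.cV ⊥ = P.e00).trans h1)).symm hy
    · exact h1
    · exact absurd h1 (cV_ne_red ⊥ f)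
  · intro h
    exact ⟨Finset.mem_univ _, Or.inr (Or.inl ⟨rfl, h⟩)⟩

theorem redOf_recT {mult : P.Ered → ℕ} {x0 y0 : P.Vred} :
    P.redOf (recT mult x0 y0) = P.mSupport mult := by
  ext g
  rw [mem_redOf, recT, Finset.mem_filter]
  constructor
  · rintro ⟨-, ⟨y, hy, h1, h2⟩ | ⟨h1, -⟩ | ⟨f, hf, h1⟩⟩
    · exact absurd h1.symm (cV_ne_red y g)
    · exact absurd h1.symm (cV_ne_red ⊥ g)
    · rw [redToEB_injective h1]; exact hf
  · intro h
    exact ⟨Finset.mem_univ _, Or.inr (Or.inr ⟨g, h, rfl⟩)⟩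

theorem Rt_recT {mult : P.Ered → ℕ} {x0 y0 x : P.Vred} :
    Rt (recT mult x0 y0) x ↔ x = ⊥ ∨ Rc mult x0 y0 x := by
  unfold Rt
  by_cases hx : x = ⊥
  · simp [hx]
  · rw [cV_mem_recT hx]

theorem not_CA_le {mult : P.Ered → ℕ} (h : P.Is2ERF mult) {v : P.Vred} (hv : ¬ CA mult v) :
    P.compEdgeRoots mult v ≤ 1 := by
  have h2 := h.2.1 v
  by_cases hb : MR mult v ⊥
  · rw [compCount_bot hb] at h2; omega
  · have h3 : P.compCount mult v ≠ 2 := fun h3 => hv ⟨h3, hb⟩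
    rw [compCount_not_bot hb] at h2 h3; omega

/-- In a component of the second kind, edges with multiplicity at least two are unique. -/
theorem edge_unique {mult : P.Ered → ℕ} (h : P.Is2ERF mult) {v u u' : P.Vred} (hv : ¬ CA mult v)
    {e e' : P.Ered} (he : e ∈ P.mSupport mult)
    (hu : u ∈ P.endsRed e) (hvu : MR mult v u) (he' : e' ∈ P.mSupport mult)
    (hu' : u' ∈ P.endsRed e') (hvu' : MR mult v u') (h2 : 2 ≤ mult e) (h2' : 2 ≤ mult e') :
    e = e' := by
  by_contra hne
  have h1 := cer_two he hu hvu he' hu' hvu' hne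
  have h3 := not_CA_le h hv
  omega

theorem Rc.unique {mult : P.Ered → ℕ} (h : P.Is2ERF mult) {x0 y0 x y : P.Vred}
    (hx : Rc mult x0 y0 x) (hy : Rc mult x0 y0 y) (hA : ¬ CA mult x) (hxy : MR mult x y) :
    x = y := by
  have hA' : ¬ CA mult y := fun h1 => hA (h1.congr hxy.symm)
  have hx := (hx.resolve_left (fun h1 => hA h1.1)).2
  have hy := (hy.resolve_left (fun h1 => hA' h1.1)).2
  rcases hx with ⟨e, he2, he⟩ | ⟨h1, h2⟩ <;> rcases hy with ⟨e', he2', he'⟩ | ⟨h1', h2'⟩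
  · have := edge_unique h hA he.1 he.2.1 (Reachable.refl _) he'.1 he'.2.1 hxy he2 he2'
    subst this
    rw [← mn_congr hxy] at he'
    exact FirstE.inj h.1 he he'
  · have := cer_one he.1 he.2.1 hxy.symm
    omega
  · have := cer_one he'.1 he'.2.1 hxy
    omega
  · rw [h1, h1', mn_congr hxy]

/-- Every edge with multiplicity at least two in a component of the second kind yields a root. -/
theorem Rc.exists {mult : P.Ered → ℕ} (h : P.Is2ERF mult) {x0 y0 v u : P.Vred} {e : P.Ered}
    (hA : ¬ CA mult v) (he : e ∈ P.mSupport mult) (hu : u ∈ P.endsRed e) (hvu : MR mult v u)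
    (h2 : 2 ≤ mult e) :
    ∃ x, x ≠ ⊥ ∧ Rc mult x0 y0 x ∧ MR mult v x ∧
      FE (P.mSupport mult) x (mn (P.mSupport mult) v) e := by
  obtain ⟨x, hx⟩ := FirstE.surj h.1 he hu (hvu.symm.trans (mn_reach _ v))
  have hvx : MR mult v x := hvu.trans (Reachable.of_mem he hu hx.2.1)
  refine ⟨x, ?_, Or.inr ⟨fun h1 => hA (h1.congr hvx.symm), Or.inl ⟨e, h2, ?_⟩⟩, hvx, hx⟩
  · rintro rfl
    exact hx.ne (mn_bot hvx).symm
  · rw [← mn_congr hvx]; exact hx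

theorem Rc.pair_bot {mult : P.Ered → ℕ} (h : P.Is2ERF mult) {x0 y0 x : P.Vred}
    (hx : Rc mult x0 y0 x) (hx0 : x ≠ ⊥) (hb : MR mult x ⊥) :
    P.side ⊥ ≠ P.side x ∧ P.compCount mult x = 2 := by
  have hA : ¬ CA mult x := fun h1 => h1.2 hb
  have hx := (hx.resolve_left (fun h1 => hA h1.1)).2
  rw [mn_bot hb] at hx
  rcases hx with ⟨e, he2, he⟩ | ⟨h1, -⟩
  swap
  · exact absurd h1 hx0
  have h2 : P.compCount mult x = 2 := by
    have h3 := cer_one he.1 he.2.1 (Reachable.refl (F := P.mSupport mult) x)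
    have h4 := h.2.1 x
    rw [compCount_bot hb] at h4 ⊢
    omega
  refine ⟨?_, h2⟩
  obtain ⟨y, p, hp, hpF, ⟨f, hf, hf2⟩, hodd⟩ := (h.2.2.2 x h2).1 hb
  rw [MWalk.odd_bridgeCount] at hodd
  have hf' := p.first_of_last h.1 hp hpF hf
  have := edge_unique h hA he.1 he.2.1 (Reachable.refl _) hf'.1 hf'.2.1
    (hb.trans hf'.2.2.1.symm) he2 hf2
  subst this
  rw [FirstE.inj h.1 he hf']
  exact hodd

theorem Rc.pair {mult : P.Ered → ℕ} (h : P.Is2ERF mult) {x0 y0 : P.Vred}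
    (hD : ∀ v, CA mult v → AData mult x0 y0 v) {r s : P.Vred}
    (hr : r = ⊥ ∨ Rc mult x0 y0 r) (hs : s = ⊥ ∨ Rc mult x0 y0 s) (hne : r ≠ s)
    (hrs : MR mult r s) : P.side r ≠ P.side s ∧ P.compCount mult r = 2 := by
  by_cases hA : CA mult r
  · refine ⟨?_, hA.1⟩
    have hA' := hA.congr hrs
    have hr0 : r ≠ ⊥ := by rintro rfl; exact hA.2 (Reachable.refl _)
    have hs0 : s ≠ ⊥ := by rintro rfl; exact hA'.2 (Reachable.refl _)
    have hr := ((hr.resolve_left hr0).resolve_right (fun h1 => h1.1 hA)).2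
    have hs := ((hs.resolve_left hs0).resolve_right (fun h1 => h1.1 hA')).2
    have hsd := (hD r hA).sd
    rcases hr with rfl | rfl <;> rcases hs with rfl | rfl
    · exact absurd rfl hne
    · exact hsd
    · exact hsd.symm
    · exact absurd rfl hne
  · by_cases hr0 : r = ⊥
    · subst hr0
      have := Rc.pair_bot h (hs.resolve_left hne.symm) hne.symm hrs.symm
      exact ⟨this.1, (compCount_congr hrs).trans this.2⟩
    · by_cases hs0 : s = ⊥
      · subst hs0
        have := Rc.pair_bot h (hr.resolve_left hne) hne hrs
        exact ⟨this.1.symm, this.2⟩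
      · exact absurd (Rc.unique h (hr.resolve_left hr0) (hs.resolve_left hs0) hA hrs) hne

theorem RR_recT {mult : P.Ered → ℕ} {x0 y0 u v : P.Vred} :
    RR (recT mult x0 y0) u v ↔ MR mult u v := by
  unfold RR; rw [redOf_recT]

theorem AData.root {mult : P.Ered → ℕ} {x0 y0 v : P.Vred} (hA : CA mult v)
    (hD : AData mult x0 y0 v) : Rc mult x0 y0 x0 ∧ Rc mult x0 y0 y0 ∧ x0 ≠ ⊥ ∧ y0 ≠ ⊥ := by
  refine ⟨Or.inl ⟨hA.congr hD.rx, Or.inl rfl⟩, Or.inl ⟨hA.congr hD.ry, Or.inr rfl⟩, ?_, ?_⟩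
  · rintro rfl; exact hA.2 hD.rx
  · rintro rfl; exact hA.2 hD.ry

theorem good_recT {mult : P.Ered → ℕ} (h : P.Is2ERF mult) {x0 y0 : P.Vred}
    (hD : ∀ v, CA mult v → AData mult x0 y0 v) : Good (recT mult x0 y0) := by
  refine ⟨?_, ?_, ?_, ?_, ?_⟩
  · rw [redOf_recT]; exact h.1
  · intro v
    simp only [RR_recT, Rt_recT]
    by_cases hb : MR mult v ⊥
    · exact ⟨⊥, Or.inl rfl, hb⟩
    by_cases hA : CA mult v
    · have hd := hD v hA
      exact ⟨x0, Or.inr (hd.root hA).1, hd.rx⟩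
    · by_cases h0 : P.compEdgeRoots mult v = 0
      · refine ⟨mn (P.mSupport mult) v, Or.inr (Or.inr ⟨?_, Or.inr ⟨?_, ?_⟩⟩), mn_reach _ v⟩
        · exact fun h1 => hA (h1.congr (mn_reach _ v).symm)
        · exact mn_congr (mn_reach _ v)
        · rw [← cer_congr (mn_reach _ v)]; exact h0
      · obtain ⟨e, he, ⟨u, hu, hvu⟩, h2⟩ := cer_pos h0
        obtain ⟨x, -, h3, h4, -⟩ := Rc.exists (x0 := x0) (y0 := y0) h hA he hu hvu h2
        exact ⟨x, Or.inr h3, h4⟩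
  · intro r s hr hs hne hrs
    rw [Rt_recT] at hr hs
    rw [RR_recT] at hrs
    have := Rc.pair h hD hr hs hne hrs
    refine ⟨this.1, ?_⟩
    rw [e00_mem_recT, not_not]
    exact ⟨r, this.2⟩
  · intro r s r' s' hr hs hne hrs hr' hs' hne' hrs'
    rw [Rt_recT] at hr hs hr' hs'
    rw [RR_recT] at hrs hrs' ⊢
    exact h.2.2.1 r r' (Rc.pair h hD hr hs hne hrs).2 (Rc.pair h hD hr' hs' hne' hrs').2
  · intro h0
    rw [e00_mem_recT, not_not] at h0
    obtain ⟨v, hv⟩ := h0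
    simp only [RR_recT, Rt_recT]
    by_cases hA : CA mult v
    · have hd := hD v hA
      have hr := hd.root hA
      exact ⟨x0, y0, Or.inr hr.1, Or.inr hr.2.1, hd.ne, hd.rx.symm.trans hd.ry⟩
    · have hb : MR mult v ⊥ := by
        by_contra hb
        exact hA ⟨hv, hb⟩
      have h0 : P.compEdgeRoots mult v ≠ 0 := by
        rw [compCount_bot hb] at hv; omega
      obtain ⟨e, he, ⟨u, hu, hvu⟩, h2⟩ := cer_pos h0
      obtain ⟨x, hx0, h3, h4, -⟩ := Rc.exists (x0 := x0) (y0 := y0) h hA he hu hvu h2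
      exact ⟨x, ⊥, Or.inr h3, Or.inl rfl, hx0, h4.symm.trans hb⟩

theorem tgt_recT_B {mult : P.Ered → ℕ} (h : P.Is2ERF mult) {x0 y0 r : P.Vred}
    (hD : ∀ v, CA mult v → AData mult x0 y0 v) (hr : Rc mult x0 y0 r) (hr0 : r ≠ ⊥)
    (hA : ¬ CA mult r) : tgt (recT mult x0 y0) r = mn (P.mSupport mult) r := by
  by_cases hb : MR mult r ⊥
  · rw [mn_bot hb]
    exact (good_recT h hD).tgt_eq (Rt_recT.2 (Or.inr hr)) (Rt_bot _) hr0.symm (RR_recT.2 hb)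
  · rw [← redOf_recT (x0 := x0) (y0 := y0)]
    refine tgt_eq_mn ?_
    intro s hs hne hrs
    rw [RR_recT] at hrs
    rcases Rt_recT.1 hs with rfl | hs
    · exact hb hrs
    · exact hne (Rc.unique h hr hs hA hrs).symm

theorem multOf_recT {mult : P.Ered → ℕ} (h : P.Is2ERF mult) {x0 y0 : P.Vred}
    (hD : ∀ v, CA mult v → AData mult x0 y0 v) : multOf (recT mult x0 y0) = mult := by
  have hG := good_recT h hD
  funext e
  unfold multOf
  rw [redOf_recT]
  by_cases he : e ∈ P.mSupport mult
  swap
  · rw [if_neg he]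
    rw [mem_mSupport, not_not] at he
    exact he.symm
  rw [if_pos he]
  have he0 := mem_mSupport.1 he
  obtain ⟨v, hv⟩ : ∃ v, v ∈ P.endsRed e := by
    induction P.endsRed e with
    | h a b => exact ⟨a, by simp⟩
  have hmk : ∀ r, r ∈ marks (recT mult x0 y0) e ↔
      r ≠ ⊥ ∧ Rc mult x0 y0 r ∧ FE (P.mSupport mult) r (tgt (recT mult x0 y0) r) e := by
    intro r
    rw [mem_marks, redOf_recT]
    constructor
    · rintro ⟨h1, h2, h3⟩; exact ⟨h1, (cV_mem_recT h1).1 h2, h3⟩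
    · rintro ⟨h1, h2, h3⟩; exact ⟨h1, (cV_mem_recT h1).2 h2, h3⟩
  by_cases hA : CA mult v
  · have hd := hD v hA
    obtain ⟨rx, ry, hx0, hy0⟩ := hd.root hA
    have hxy : RR (recT mult x0 y0) x0 y0 := RR_recT.2 (hd.rx.symm.trans hd.ry)
    have tx := hG.tgt_eq (Rt_recT.2 (Or.inr rx)) (Rt_recT.2 (Or.inr ry)) hd.ne.symm hxy
    have ty := hG.tgt_eq (Rt_recT.2 (Or.inr ry)) (Rt_recT.2 (Or.inr rx)) hd.ne hxy.symm
    obtain ⟨e1, f1, h1, h2, h3, h4, h5⟩ := hd.ex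
    have mx : x0 ∈ marks (recT mult x0 y0) e ↔ e = e1 := by
      rw [hmk, tx]
      constructor
      · rintro ⟨-, -, h6⟩; exact FirstE.unique h.1 h6 h1
      · rintro rfl; exact ⟨hx0, rx, h1⟩
    have my : y0 ∈ marks (recT mult x0 y0) e ↔ e = f1 := by
      rw [hmk, ty]
      constructor
      · rintro ⟨-, -, h6⟩; exact FirstE.unique h.1 h6 h2
      · rintro rfl; exact ⟨hy0, ry, h2⟩
    have hsub : marks (recT mult x0 y0) e ⊆ {x0, y0} := by
      intro r hr
      obtain ⟨-, h7, h8⟩ := (hmk r).1 hr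
      have hAr : CA mult r := hA.congr (Reachable.of_mem he hv h8.2.1)
      have := (h7.resolve_right (fun h1 => h1.1 hAr)).2
      simpa using this
    have hc2 : P.compEdgeRoots mult v = 2 := by
      rw [← compCount_not_bot hA.2]; exact hA.1
    have hcard : (marks (recT mult x0 y0) e).card =
        (if e = e1 then 1 else 0) + (if e = f1 then 1 else 0) := by
      have hm : marks (recT mult x0 y0) e =
          ({x0, y0} : Finset P.Vred).filter (fun r => r ∈ marks (recT mult x0 y0) e) := by
        ext r
        rw [Finset.mem_filter]
        exact ⟨fun h => ⟨hsub h, h⟩, fun h => h.2⟩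
      rw [hm, Finset.card_filter, Finset.sum_pair hd.ne]
      simp only [mx, my]
    rw [hcard]
    have hv1 : MR mult v v := Reachable.refl _
    by_cases hef : e1 = f1
    · have h6 := h5 hef
      subst hef
      by_cases hee : e = e1
      · rw [if_pos hee, hee, h6]
      · rw [if_neg hee]
        have := cer_two he hv hv1 h1.1 h1.2.1 hd.rx hee
        omega
    · have h7 := cer_two h1.1 h1.2.1 hd.rx h2.1 h2.2.1 hd.ry hef
      by_cases hee : e = e1
      · have : e ≠ f1 := by rw [hee]; exact hef
        rw [if_pos hee, if_neg this, hee]; omega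
      · by_cases hff : e = f1
        · rw [if_neg hee, if_pos hff, hff]; omega
        · rw [if_neg hee, if_neg hff]
          have := cer_three he hv hv1 h1.1 h1.2.1 hd.rx h2.1 h2.2.1 hd.ry hee hff hef
          omega
  · have hin : ∀ r, r ∈ marks (recT mult x0 y0) e → MR mult v r ∧ 2 ≤ mult e := by
      intro r hr
      obtain ⟨hr0, h7, h8⟩ := (hmk r).1 hr
      have hvr : MR mult v r := Reachable.of_mem he hv h8.2.1
      have hAr : ¬ CA mult r := fun h1 => hA (h1.congr hvr.symm)
      refine ⟨hvr, ?_⟩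
      rw [tgt_recT_B h hD h7 hr0 hAr] at h8
      rcases (h7.resolve_left (fun h1 => hAr h1.1)).2 with ⟨e', he2, he'⟩ | ⟨h1, -⟩
      · rw [FirstE.unique h.1 h8 he']; exact he2
      · exact absurd h1 h8.ne
    by_cases h2 : 2 ≤ mult e
    · obtain ⟨x, hx0, h3, h4, h5⟩ :=
        Rc.exists (x0 := x0) (y0 := y0) h hA he hv (Reachable.refl _) h2
      have hAx : ¬ CA mult x := fun h1 => hA (h1.congr h4.symm)
      have hm : marks (recT mult x0 y0) e = {x} := by
        ext r
        rw [Finset.mem_singleton]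
        constructor
        · intro hr
          have h7 := hin r hr
          exact (Rc.unique h h3 ((hmk r).1 hr).2.1 hAx (h4.symm.trans h7.1)).symm
        · rintro rfl
          rw [hmk, tgt_recT_B h hD h3 hx0 hAx, ← mn_congr h4]
          exact ⟨hx0, h3, h5⟩
      rw [hm, Finset.card_singleton]
      have h6 := cer_one he hv (Reachable.refl (F := P.mSupport mult) v)
      have h7 := not_CA_le h hA
      omega
    · have hm : marks (recT mult x0 y0) e = ∅ := by
        apply Finset.eq_empty_of_forall_notMem
        intro r hr
        exact h2 (hin r hr).2
      rw [hm, Finset.card_empty]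
      omega

end BiconedGraph

/-- Corollary 3.6 together with Lemma 4.2.  For any biconed
graph `G^{A,B}` there is a bijection `φ` from the set of spanning trees of
`G^{A,B}` to the set of 2-edge-rooted forests of `G^{A,B}_red` such that the
number of internally passive edges of a spanning tree `T` (with respect to
any fixed linear edge order refining the lexicographic order on endpoints)
equals the degree of `φ T`. -/
theorem exists_equiv_ipCount_eq_deg (P : BiconedGraph)
    (ord : LinearOrder P.EB) (hord : P.AdmissibleOrder ord) :
    ∃ φ : {T : Finset P.EB // IsSpanningTree P.endsB T} ≃
        {mult : P.Ered → ℕ // P.Is2ERF mult},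
      ∀ T : {T : Finset P.EB // IsSpanningTree P.endsB T},
        P.ipCount ord T.1 = P.deg (φ T).1 := by
  refine ⟨Equiv.ofBijective (fun T => ⟨BiconedGraph.multOf T.1,
    (BiconedGraph.good_of_tree T.2).is2ERF⟩) ⟨?_, ?_⟩, ?_⟩
  · intro T T' hTT
    exact Subtype.ext ((BiconedGraph.good_of_tree T.2).inj (BiconedGraph.good_of_tree T'.2)
      (congrArg Subtype.val hTT))
  · rintro ⟨mult, h⟩
    obtain ⟨x0, y0, hD⟩ := BiconedGraph.exists_AData h
    exact ⟨⟨BiconedGraph.recT mult x0 y0,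
      BiconedGraph.tree_of_good (BiconedGraph.good_recT h hD)⟩,
      Subtype.ext (BiconedGraph.multOf_recT h hD)⟩
  · intro T
    show P.ipCount ord T.1 = P.deg (BiconedGraph.multOf T.1)
    rw [BiconedGraph.ipCount_eq hord T.2, BiconedGraph.deg_multOf (BiconedGraph.good_of_tree T.2).acyc]

end

end BiconedPaper
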